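/- arXiv:1211.7053 — 4 statements merged into one kernel-verified Lean document; each statement's English description precedes it below -/
import Mathlib

section
/- Let X ⊆ ℝ^d be a Delaunay set with parameters 0 < r < R, let x ∈ ℝ^d, let u be a unit vector in ℝ^d, and let 0 < ε. Then the open cone with apex x, axis direction u and half-angle ε, i.e. the set of points y ≠ x such that the angle between y − x and u is less than ε, contains infinitely many points of X. -/
open Metric MeasureTheory Filter

noncomputable section

/-- A Delaunay set with parameters `r < R`: every open ball of radius `r` contains at most
one point of `X`, and every closed ball of radius `R` contains at least one point of `X`. -/
def DelaunaySet (d : ℕ) (X : Set (EuclideanSpace ℝ (Fin d))) (r R : ℝ) : Prop :=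
  (∀ z : EuclideanSpace ℝ (Fin d), (X ∩ Metric.ball z r).Subsingleton) ∧
  (∀ z : EuclideanSpace ℝ (Fin d), (X ∩ Metric.closedBall z R).Nonempty)

/-- Every open cone with nonempty interior (apex `x`, unit axis direction `u`,
half-angle `ε > 0`) contains infinitely many points of a Delaunay set. -/
theorem cone_infinite (d : ℕ) (X : Set (EuclideanSpace ℝ (Fin d))) (r R : ℝ)
    (hr : 0 < r) (hrR : r < R) (hX : DelaunaySet d X r R)
    (x u : EuclideanSpace ℝ (Fin d)) (hu : ‖u‖ = 1) (ε : ℝ) (hε : 0 < ε) :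
    (X ∩ {y : EuclideanSpace ℝ (Fin d) |
        y ≠ x ∧ InnerProductGeometry.angle (y - x) u < ε}).Infinite := by
  have hu0 : u ≠ 0 := norm_ne_zero_iff.mp (by simp [hu])
  have hcont : ContinuousAt (fun v => InnerProductGeometry.angle v u) u :=
    (InnerProductGeometry.continuousAt_angle (x := (u, u)) hu0 hu0).comp
      (f := fun v => (v, u)) (by fun_prop)
  have hev : ∀ᶠ v in nhds u, InnerProductGeometry.angle v u < ε :=
    hcont.eventually_lt continuousAt_const
      (by simpa [InnerProductGeometry.angle_self hu0] using hε)
  obtain ⟨δ, hδ, hball⟩ := Metric.eventually_nhds_iff.mp hev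
  have hR : 0 < R := hr.trans hrR
  intro hfin
  obtain ⟨M, hM⟩ := hfin.isBounded.subset_closedBall x
  obtain ⟨t, ht⟩ := exists_gt (max (R / δ) (R + max M 0))
  have htδ : R / δ < t := (le_max_left _ _).trans_lt ht
  have htM : R + max M 0 < t := (le_max_right _ _).trans_lt ht
  have ht0 : 0 < t := (div_pos hR hδ).trans htδ
  obtain ⟨y, hyX, hy⟩ := hX.2 (x + t • u)
  have hyR : ‖(y - x) - t • u‖ ≤ R := by
    rwa [mem_closedBall, dist_eq_norm, ← sub_sub] at hy
  have hfar : max M 0 < ‖y - x‖ := by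
    have h := norm_sub_norm_le (t • u) (y - x)
    rw [norm_sub_rev (t • u), norm_smul, hu, mul_one, Real.norm_of_nonneg ht0.le] at h
    linarith
  have hyx : y ≠ x := by
    rintro rfl
    simp at hfar
  have hangle : InnerProductGeometry.angle (y - x) u < ε := by
    rw [← InnerProductGeometry.angle_smul_left_of_pos (y - x) u (inv_pos.mpr ht0)]
    apply hball
    have hsub : t⁻¹ • (y - x) - u = t⁻¹ • ((y - x) - t • u) := by
      rw [smul_sub _ (y - x), inv_smul_smul₀ ht0.ne']
    rw [dist_eq_norm, hsub, norm_smul, Real.norm_of_nonneg (inv_pos.mpr ht0).le]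
    calc t⁻¹ * ‖(y - x) - t • u‖ ≤ t⁻¹ * R := by gcongr
      _ < δ := by
        rw [inv_mul_lt_iff₀ ht0]
        exact (div_lt_iff₀ hδ).mp htδ
  have hle := hM ⟨hyX, hyx, hangle⟩
  rw [mem_closedBall, dist_eq_norm] at hle
  exact absurd ((le_max_left M 0).trans_lt hfar) hle.not_gt
end
end

section
/- There exists a Delaunay set X ⊆ ℝ³ (with some parameters 0 < r < R) such that for every ε > 0 there exist four affinely independent points of X whose open circumball contains no point of X and whose convex hull has volume strictly between 0 and ε. In other words, there is a Delaunay set in ℝ³ whose Delaunay triangulation contains tetrahedra of arbitrarily small positive volume. -/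
open Metric MeasureTheory Filter

noncomputable section

/-- The height assigned to the column `a`: zero for odd `a`, positive for even `a`, and tending
to zero along the even integers. -/
def sliverHeight (a : ℤ) : ℝ := if Even a then 1 / (4 * (|(a : ℝ)| + 1)) else 0

lemma sliverHeight_nonneg (a : ℤ) : 0 ≤ sliverHeight a := by
  unfold sliverHeight
  split_ifs <;> positivity

lemma sliverHeight_le (a : ℤ) : sliverHeight a ≤ 1 / 4 := by
  unfold sliverHeight
  split_ifs
  · apply one_div_le_one_div_of_le <;> linarith [abs_nonneg (a : ℝ)]
  · norm_num

lemma exists_sliverHeight_lt {ε : ℝ} (hε : 0 < ε) :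
    ∃ a : ℤ, 0 < sliverHeight a ∧ sliverHeight a < ε ∧ sliverHeight (a - 1) = 0 := by
  obtain ⟨n, hn⟩ := exists_nat_one_div_lt hε
  have hval : sliverHeight (2 * n) = 1 / (4 * (2 * (n : ℝ) + 1)) := by
    simp [sliverHeight]
  refine ⟨2 * n, ?_, ?_, ?_⟩
  · rw [hval]; positivity
  · rw [hval]
    refine lt_of_le_of_lt ?_ hn
    apply one_div_le_one_div_of_le
    · positivity
    · linarith [Nat.cast_nonneg (α := ℝ) n]
  · have : ¬ Even (2 * (n : ℤ) - 1) := by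
      rw [Int.not_even_iff_odd]
      exact ⟨n - 1, by ring⟩
    simp [sliverHeight, this]

/-- The displacement in the second coordinate that keeps the point `(1, 0)` of the plane on the
circle around `(1/2, 1/2)` through the origin when it is lifted to height `h`. -/
def circleShift (h : ℝ) : ℝ := √(1 / 4 + h - h ^ 2) - 1 / 2

lemma circleShift_zero : circleShift 0 = 0 := by
  have : √(1 / 4 : ℝ) = 1 / 2 := by
    rw [Real.sqrt_eq_iff_mul_self_eq] <;> norm_num
  rw [circleShift]
  norm_num [this]

lemma circleShift_sq {h : ℝ} (h0 : 0 ≤ h) (h1 : h ≤ 1 / 4) :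
    (1 / 2 + circleShift h) ^ 2 = 1 / 4 + h - h ^ 2 := by
  have := Real.sq_sqrt (show 0 ≤ 1 / 4 + h - h ^ 2 by nlinarith)
  rw [circleShift]
  linarith

lemma circleShift_nonneg {h : ℝ} (h0 : 0 ≤ h) (h1 : h ≤ 1 / 4) : 0 ≤ circleShift h := by
  have : 1 / 2 ≤ √(1 / 4 + h - h ^ 2) := Real.le_sqrt_of_sq_le (by nlinarith)
  rw [circleShift]
  linarith

lemma circleShift_le {h : ℝ} (h1 : h ≤ 1 / 4) : circleShift h ≤ 1 / 4 := by
  have : √(1 / 4 + h - h ^ 2) ≤ 3 / 4 := Real.sqrt_le_iff.2 ⟨by norm_num, by nlinarith⟩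
  rw [circleShift]
  linarith

/-- The height by which the lattice point `(a, b, c)` is lifted: only the points of the line
`b = 1`, `c = 0` are moved. -/
def latticeLift (a b c : ℤ) : ℝ := if b = 1 ∧ c = 0 then sliverHeight a else 0

lemma latticeLift_nonneg (a b c : ℤ) : 0 ≤ latticeLift a b c := by
  unfold latticeLift
  split_ifs
  · exact sliverHeight_nonneg a
  · exact le_rfl

lemma latticeLift_le (a b c : ℤ) : latticeLift a b c ≤ 1 / 4 := by
  unfold latticeLift
  split_ifs
  · exact sliverHeight_le a
  · norm_num

/-- The perturbed position of the lattice point `(a, b, c)`. -/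
def perturbedPoint (a b c : ℤ) : EuclideanSpace ℝ (Fin 3) :=
  !₂[(a : ℝ), b + circleShift (latticeLift a b c), c + latticeLift a b c]

/-- The cubic lattice with the points of one line rotated slightly around a parallel line. -/
def perturbedLattice : Set (EuclideanSpace ℝ (Fin 3)) :=
  {x | ∃ a b c : ℤ, perturbedPoint a b c = x}

lemma perturbedPoint_mem (a b c : ℤ) : perturbedPoint a b c ∈ perturbedLattice := ⟨a, b, c, rfl⟩

lemma circleShift_latticeLift_mem (a b c : ℤ) :
    circleShift (latticeLift a b c) ∈ Set.Icc (0 : ℝ) (1 / 4) :=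
  ⟨circleShift_nonneg (latticeLift_nonneg a b c) (latticeLift_le a b c),
    circleShift_le (latticeLift_le a b c)⟩

lemma abs_apply_sub_le_dist {ι : Type*} [Fintype ι] (x y : EuclideanSpace ℝ ι) (i : ι) :
    |x i - y i| ≤ dist x y := by
  simpa [dist_eq_norm] using PiLp.norm_apply_le (x - y) i

lemma Int.eq_of_abs_cast_sub_lt_one {m n : ℤ} (h : |(m : ℝ) - n| < 1) : m = n := by
  have : |m - n| < 1 := by exact_mod_cast h
  have := Int.abs_lt_one_iff.1 this
  omega

lemma delaunaySet_perturbedLattice : DelaunaySet 3 perturbedLattice (1 / 4) 2 := by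
  constructor
  · rintro z _ ⟨⟨a, b, c, rfl⟩, hx⟩ _ ⟨⟨a', b', c', rfl⟩, hy⟩
    have hd : dist (perturbedPoint a b c) (perturbedPoint a' b' c') < 1 / 2 := by
      have := dist_triangle_right (perturbedPoint a b c) (perturbedPoint a' b' c') z
      rw [Metric.mem_ball] at hx hy
      linarith
    have key (i : Fin 3) := abs_lt.1 <| (abs_apply_sub_le_dist _ _ i).trans_lt hd
    have k0 := key 0
    have k1 := key 1
    have k2 := key 2
    simp only [perturbedPoint, PiLp.toLp_apply, Matrix.cons_val] at k0 k1 k2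
    have g := circleShift_latticeLift_mem a b c
    have g' := circleShift_latticeLift_mem a' b' c'
    have l := latticeLift_nonneg a b c
    have l' := latticeLift_nonneg a' b' c'
    have m := latticeLift_le a b c
    have m' := latticeLift_le a' b' c'
    obtain rfl : a = a' := Int.eq_of_abs_cast_sub_lt_one (by rw [abs_lt]; constructor <;> linarith)
    obtain rfl : b = b' := Int.eq_of_abs_cast_sub_lt_one
      (by rw [abs_lt]; constructor <;> linarith [g.1, g.2, g'.1, g'.2])
    obtain rfl : c = c' := Int.eq_of_abs_cast_sub_lt_one (by rw [abs_lt]; constructor <;> linarith)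
    rfl
  · intro z
    refine ⟨_, perturbedPoint_mem (round (z 0)) (round (z 1)) (round (z 2)), ?_⟩
    rw [Metric.mem_closedBall, EuclideanSpace.dist_eq, Fin.sum_univ_three]
    simp only [perturbedPoint, PiLp.toLp_apply, Matrix.cons_val, Real.dist_eq, sq_abs]
    have h0 := abs_le.1 (abs_sub_round (z 0))
    have h1 := abs_le.1 (abs_sub_round (z 1))
    have h2 := abs_le.1 (abs_sub_round (z 2))
    have g := circleShift_latticeLift_mem (round (z 0)) (round (z 1)) (round (z 2))
    have l := latticeLift_nonneg (round (z 0)) (round (z 1)) (round (z 2))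
    have m := latticeLift_le (round (z 0)) (round (z 1)) (round (z 2))
    have sq_le {x : ℝ} (h : -(3 / 4) ≤ x) (h' : x ≤ 3 / 4) : x ^ 2 ≤ 9 / 16 := by nlinarith
    refine Real.sqrt_le_iff.2 ⟨by norm_num, ?_⟩
    have s0 := sq_le (x := round (z 0) - z 0) (by linarith) (by linarith)
    have s1 := sq_le (x := round (z 1) +
      circleShift (latticeLift (round (z 0)) (round (z 1)) (round (z 2))) - z 1)
      (by linarith [g.1]) (by linarith [g.2])
    have s2 := sq_le (x := round (z 2) +
      latticeLift (round (z 0)) (round (z 1)) (round (z 2)) - z 2) (by linarith) (by linarith)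
    linarith

lemma Int.one_fourth_le_cast_sub_half_sq (n : ℤ) : (1 / 4 : ℝ) ≤ (n - 1 / 2) ^ 2 := by
  have : 0 ≤ n * (n - 1) := by
    rcases le_or_gt n 0 with h | h <;> nlinarith
  have : (0 : ℝ) ≤ n * (n - 1) := by exact_mod_cast this
  linarith

/-- The centre of the lattice cube whose first coordinates lie in `[a - 1, a]`. -/
def cubeCenter (a : ℤ) : EuclideanSpace ℝ (Fin 3) := !₂[(a : ℝ) - 1 / 2, 1 / 2, 1 / 2]

lemma dist_perturbedPoint_cubeCenter (a a' b c : ℤ) :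
    dist (perturbedPoint a' b c) (cubeCenter a) =
      √((a' - (a - 1 / 2)) ^ 2 + (b + circleShift (latticeLift a' b c) - 1 / 2) ^ 2 +
        (c + latticeLift a' b c - 1 / 2) ^ 2) := by
  rw [EuclideanSpace.dist_eq, Fin.sum_univ_three]
  simp only [perturbedPoint, cubeCenter, PiLp.toLp_apply, Matrix.cons_val, Real.dist_eq, sq_abs]

lemma latticeLift_eq_zero {a b c : ℤ} (h : ¬ (b = 1 ∧ c = 0)) : latticeLift a b c = 0 :=
  if_neg h

lemma latticeLift_one_zero (a : ℤ) : latticeLift a 1 0 = sliverHeight a := by simp [latticeLift]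

lemma le_dist_cubeCenter (a a' b c : ℤ) :
    √(3 / 4) ≤ dist (perturbedPoint a' b c) (cubeCenter a) := by
  rw [dist_perturbedPoint_cubeCenter]
  apply Real.sqrt_le_sqrt
  have h0 := Int.one_fourth_le_cast_sub_half_sq (a' - a + 1)
  push_cast at h0
  by_cases h : b = 1 ∧ c = 0
  · obtain ⟨rfl, rfl⟩ := h
    have := circleShift_sq (sliverHeight_nonneg a') (sliverHeight_le a')
    rw [latticeLift_one_zero]
    push_cast
    linarith
  · rw [latticeLift_eq_zero h, circleShift_zero]
    have h1 := Int.one_fourth_le_cast_sub_half_sq b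
    have h2 := Int.one_fourth_le_cast_sub_half_sq c
    linarith

lemma dist_perturbedPoint_cubeCenter_of_mem {a a' b : ℤ} (ha : a' = a ∨ a' = a - 1)
    (hb : b = 0 ∨ b = 1) : dist (perturbedPoint a' b 0) (cubeCenter a) = √(3 / 4) := by
  rw [dist_perturbedPoint_cubeCenter]
  congr 1
  have h0 : ((a' : ℝ) - (a - 1 / 2)) ^ 2 = 1 / 4 := by
    rcases ha with rfl | rfl <;> push_cast <;> ring
  rcases hb with rfl | rfl
  · rw [h0, latticeLift_eq_zero (by simp), circleShift_zero]
    norm_num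
  · have := circleShift_sq (sliverHeight_nonneg a') (sliverHeight_le a')
    rw [h0, latticeLift_one_zero]
    push_cast
    linarith

/-- The tetrahedron on the bottom face of a lattice cube. -/
def sliver (a : ℤ) : Fin 4 → EuclideanSpace ℝ (Fin 3) :=
  ![perturbedPoint (a - 1) 0 0, perturbedPoint a 0 0, perturbedPoint (a - 1) 1 0,
    perturbedPoint a 1 0]

lemma perturbedPoint_zero_zero (a : ℤ) : perturbedPoint a 0 0 = !₂[(a : ℝ), 0, 0] := by
  simp [perturbedPoint, latticeLift, circleShift_zero]

lemma perturbedPoint_one_zero (a : ℤ) :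
    perturbedPoint a 1 0 = !₂[(a : ℝ), 1 + circleShift (sliverHeight a), sliverHeight a] := by
  simp [perturbedPoint, latticeLift]

lemma affineIndependent_sliver {a : ℤ} (ha : 0 < sliverHeight a) (ha' : sliverHeight (a - 1) = 0) :
    AffineIndependent ℝ (sliver a) := by
  rw [affineIndependent_iff_of_fintype]
  intro w hw hv
  rw [Finset.weightedVSub_eq_linear_combination _ hw] at hv
  have h (i : Fin 3) := congrArg (fun x : EuclideanSpace ℝ (Fin 3) => x i) hv
  have h0 := h 0
  have h1 := h 1
  have h2 := h 2
  simp [sliver, Fin.sum_univ_four, perturbedPoint_zero_zero, perturbedPoint_one_zero, ha',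
    circleShift_zero, ha.ne'] at h0 h1 h2
  rw [Fin.sum_univ_four] at hw
  simp only [h2, zero_mul, add_zero] at h0 h1 hw
  simp only [h1, zero_mul, add_zero] at h0 hw
  have e0 : w 0 = 0 := by linear_combination (a : ℝ) * hw - h0
  have e1 : w 1 = 0 := by linarith
  intro i
  fin_cases i <;> assumption

lemma EuclideanSpace.volume_setOf_forall_mem_Icc {ι : Type*} [Fintype ι] (l u : ι → ℝ) :
    volume {x : EuclideanSpace ℝ ι | ∀ i, x i ∈ Set.Icc (l i) (u i)} =
      ∏ i, ENNReal.ofReal (u i - l i) := by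
  rw [← Real.volume_Icc_pi, ← (PiLp.volume_preserving_ofLp ι).measure_preimage
    measurableSet_Icc.nullMeasurableSet]
  congr 1
  ext x
  simp [Pi.le_def, forall_and]

lemma convex_setOf_forall_mem_Icc {ι : Type*} [Fintype ι] (l u : ι → ℝ) :
    Convex ℝ {x : EuclideanSpace ℝ ι | ∀ i, x i ∈ Set.Icc (l i) (u i)} := by
  simp only [Set.ofPred_forall]
  exact convex_iInter fun i =>
    (convex_Icc (l i) (u i)).linear_preimage (EuclideanSpace.proj (𝕜 := ℝ) i).toLinearMap

lemma volume_convexHull_sliver_le {a : ℤ} (ha' : sliverHeight (a - 1) = 0) :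
    volume (convexHull ℝ (Set.range (sliver a))) ≤ ENNReal.ofReal (2 * sliverHeight a) := by
  have hh := sliverHeight_nonneg a
  have hg := circleShift_nonneg hh (sliverHeight_le a)
  have hg' := circleShift_le (sliverHeight_le a)
  have hsub : convexHull ℝ (Set.range (sliver a)) ⊆ {x : EuclideanSpace ℝ (Fin 3) |
      ∀ i, x i ∈ Set.Icc ((![a - 1, 0, 0] : Fin 3 → ℝ) i)
        ((![a, 2, sliverHeight a] : Fin 3 → ℝ) i)} := by
    refine convexHull_min ?_ (convex_setOf_forall_mem_Icc _ _)
    rintro _ ⟨j, rfl⟩ i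
    fin_cases j <;> fin_cases i <;>
      simp [sliver, perturbedPoint_zero_zero, perturbedPoint_one_zero, ha', circleShift_zero, hh]
    constructor <;> linarith
  refine (measure_mono hsub).trans (le_of_eq ?_)
  rw [EuclideanSpace.volume_setOf_forall_mem_Icc, Fin.prod_univ_three]
  simp [ENNReal.ofReal_mul]

lemma AffineIndependent.volume_convexHull_pos {v : Fin 4 → EuclideanSpace ℝ (Fin 3)}
    (hv : AffineIndependent ℝ v) : 0 < volume (convexHull ℝ (Set.range v)) := by
  apply Measure.measure_pos_of_nonempty_interior
  rw [interior_convexHull_nonempty_iff_affineSpan_eq_top,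
    hv.affineSpan_eq_top_iff_card_eq_finrank_add_one]
  simp

/-- There is a Delaunay set in `ℝ³` whose Delaunay triangulation contains tetrahedra of
arbitrarily small positive volume: for every `ε > 0` there are four affinely independent
points of `X` whose open circumball contains no point of `X` and whose convex hull has
volume strictly between `0` and `ε`. -/
theorem exists_delaunay_set_with_small_tetrahedra :
    ∃ (X : Set (EuclideanSpace ℝ (Fin 3))) (r R : ℝ), 0 < r ∧ r < R ∧
      DelaunaySet 3 X r R ∧
      ∀ ε : ℝ, 0 < ε → ∃ v : Fin 4 → EuclideanSpace ℝ (Fin 3),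
        (∀ i, v i ∈ X) ∧ AffineIndependent ℝ v ∧
        (∃ (c : EuclideanSpace ℝ (Fin 3)) (ρ : ℝ), (∀ i, dist (v i) c = ρ) ∧
          ∀ x ∈ X, ρ ≤ dist x c) ∧
        0 < (MeasureTheory.volume (convexHull ℝ (Set.range v))).toReal ∧
        (MeasureTheory.volume (convexHull ℝ (Set.range v))).toReal < ε := by
  refine ⟨perturbedLattice, 1 / 4, 2, by norm_num, by norm_num, delaunaySet_perturbedLattice, ?_⟩
  intro ε hε
  obtain ⟨a, ha, haε, ha'⟩ := exists_sliverHeight_lt (half_pos hε)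
  have hind := affineIndependent_sliver ha ha'
  have hvol := volume_convexHull_sliver_le ha'
  refine ⟨sliver a, ?_, hind, ⟨cubeCenter a, √(3 / 4), ?_, ?_⟩, ?_, ?_⟩
  · intro i
    fin_cases i <;> exact perturbedPoint_mem _ _ _
  · intro i
    fin_cases i <;> exact dist_perturbedPoint_cubeCenter_of_mem (by simp) (by simp)
  · rintro _ ⟨a', b, c, rfl⟩
    exact le_dist_cubeCenter a a' b c
  · exact ENNReal.toReal_pos hind.volume_convexHull_pos.ne'
      (hvol.trans_lt ENNReal.ofReal_lt_top).ne
  · refine (ENNReal.toReal_le_of_le_ofReal (by positivity) hvol).trans_lt ?_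
    linarith
end
end

section
/- For all r, q > 0 and every dimension d there is a constant S'' = S''(r,q,d) such that the following holds: for every Delaunay set X ⊆ ℝ^d with parameters r < R (for some R), every uniformly bounded triangulation T of X with parameter q, and every vertex x ∈ X, the number of d-simplices of T having x as a vertex is at most S''. -/
open Metric MeasureTheory Filter

noncomputable section

/-- `T` is a triangulation of `X`: a simplicial complex with vertex set exactly `X`
whose underlying space is all of `ℝ^d`. -/
def IsTriangulationOf (d : ℕ) (T : Geometry.SimplicialComplex ℝ (EuclideanSpace ℝ (Fin d)))
    (X : Set (EuclideanSpace ℝ (Fin d))) : Prop :=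
  T.vertices = X ∧ T.space = Set.univ

/-- The finset `s` admits an enclosing sphere with radius at most `q` passing through all
its vertices; for a `d`-simplex in `ℝ^d` this says its circumradius is at most `q`. -/
def HasCircumradiusLE (d : ℕ) (s : Finset (EuclideanSpace ℝ (Fin d))) (q : ℝ) : Prop :=
  ∃ c : EuclideanSpace ℝ (Fin d), ∃ ρ : ℝ, ρ ≤ q ∧ ∀ v ∈ s, dist v c = ρ

/-- `T` is uniformly bounded with parameter `q`. -/
def UniformlyBounded (d : ℕ) (T : Geometry.SimplicialComplex ℝ (EuclideanSpace ℝ (Fin d)))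
    (q : ℝ) : Prop :=
  ∀ s ∈ T.faces, s.card = d + 1 → HasCircumradiusLE d s q

/-- In a proper normed space, the number of points in a ball of fixed radius of a set having at
most one point in each open ball of radius `r` is bounded, uniformly in the set and the centre. -/
theorem exists_ncard_inter_closedBall_le {E : Type*} [NormedAddCommGroup E] [ProperSpace E]
    {r : ℝ} (hr : 0 < r) (ρ : ℝ) :
    ∃ N : ℕ, ∀ (X : Set E), (∀ z, (X ∩ Metric.ball z r).Subsingleton) →
      ∀ x, (X ∩ Metric.closedBall x ρ).Finite ∧ (X ∩ Metric.closedBall x ρ).ncard ≤ N := by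
  obtain ⟨t, -, ht, hcover⟩ := (isCompact_closedBall (0 : E) ρ).finite_cover_balls hr
  refine ⟨t.ncard, fun X hX x ↦ ?_⟩
  have hex : ∀ v ∈ X ∩ Metric.closedBall x ρ, ∃ c ∈ t, v ∈ Metric.ball (x + c) r := by
    rintro v ⟨-, hv⟩
    have hv' : v - x ∈ Metric.closedBall (0 : E) ρ := by
      simpa [dist_eq_norm] using hv
    obtain ⟨c, hc, hvc⟩ := Set.mem_iUnion₂.1 (hcover hv')
    refine ⟨c, hc, ?_⟩
    rw [Metric.mem_ball, dist_eq_norm] at hvc ⊢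
    rwa [← sub_sub]
  choose! f hft hf using hex
  have hinj : Set.InjOn f (X ∩ Metric.closedBall x ρ) := fun v hv w hw h ↦
    hX (x + f v) ⟨hv.1, hf v hv⟩ ⟨hw.1, h ▸ hf w hw⟩
  exact ⟨ht.of_injOn hft hinj, Set.ncard_le_ncard_of_injOn f hft hinj ht⟩

/-- Two points on a common sphere of radius at most `q` are at distance at most `2 * q`. -/
theorem HasCircumradiusLE.dist_le {d : ℕ} {s : Finset (EuclideanSpace ℝ (Fin d))} {q : ℝ}
    (h : HasCircumradiusLE d s q) {v w : EuclideanSpace ℝ (Fin d)} (hv : v ∈ s) (hw : w ∈ s) :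
    dist v w ≤ 2 * q := by
  obtain ⟨c, ρ, hρ, hc⟩ := h
  linarith [dist_triangle_right v w c, hc v hv, hc w hw]

/-- Simplex Count Lemma, part (i): the number of `d`-simplices of a uniformly bounded
triangulation of a Delaunay set sharing a common vertex is bounded by a constant
`S'' = S''(r,q,d)`. -/
theorem simplex_count_at_vertex (d : ℕ) (r q : ℝ) (hr : 0 < r) (hq : 0 < q) :
    ∃ S'' : ℕ, ∀ (X : Set (EuclideanSpace ℝ (Fin d))) (R : ℝ), r < R →
      DelaunaySet d X r R →
      ∀ T : Geometry.SimplicialComplex ℝ (EuclideanSpace ℝ (Fin d)),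
        IsTriangulationOf d T X → UniformlyBounded d T q →
        ∀ x ∈ X,
          {s : Finset (EuclideanSpace ℝ (Fin d)) |
            s ∈ T.faces ∧ s.card = d + 1 ∧ x ∈ s}.Finite ∧
          {s : Finset (EuclideanSpace ℝ (Fin d)) |
            s ∈ T.faces ∧ s.card = d + 1 ∧ x ∈ s}.ncard ≤ S'' := by
  obtain ⟨N, hN⟩ := exists_ncard_inter_closedBall_le
    (E := EuclideanSpace ℝ (Fin d)) hr (2 * q)
  refine ⟨2 ^ N, fun X R _ hX T hT hq' x _ ↦ ?_⟩
  obtain ⟨hfin, hcard⟩ := hN X hX.1 x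
  have hsub : {s : Finset (EuclideanSpace ℝ (Fin d)) | s ∈ T.faces ∧ s.card = d + 1 ∧ x ∈ s} ⊆
      (hfin.toFinset.powerset : Set (Finset (EuclideanSpace ℝ (Fin d)))) := by
    rintro s ⟨hs, hsd, hxs⟩
    refine Finset.mem_coe.2 (Finset.mem_powerset.2 fun v hv ↦ hfin.mem_toFinset.2 ⟨?_, ?_⟩)
    · rw [← hT.1]
      exact T.down_closed hs (Finset.singleton_subset_iff.2 hv) (Finset.singleton_nonempty v)
    · exact (hq' s hs hsd).dist_le hv hxs
  refine ⟨(Finset.finite_toSet _).subset hsub, ?_⟩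
  refine (Set.ncard_le_ncard hsub (Finset.finite_toSet _)).trans ?_
  rw [Set.ncard_coe_finset, Finset.card_powerset, ← Set.ncard_eq_toFinset_card _ hfin]
  exact Nat.pow_le_pow_right two_pos hcard
end
end

section
/- Let F be a real-valued functional on triangles in ℝ² that is invariant under isometries of ℝ² and such that for all r, q > 0 there are constants e(r,q) ≤ E(r,q) with e(r,q) ≤ F(Δ) ≤ E(r,q) for every triangle Δ whose edges have length at least 2r and whose circumradius is at most q. Suppose that for every generic Delaunay set X ⊆ ℝ² and every triangulation D of X all of whose triangles are empty, the limit lim_{α→∞} (1/vol(B_α)) · Σ_{Δ ⊆ B_α, Δ a triangle of D} F(Δ) exists. Then there is a constant c ∈ ℝ such that F(Δ) = c·Area(Δ) for every nondegenerate triangle Δ in ℝ². -/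
open Metric MeasureTheory Filter

noncomputable section

/-- The density of a functional `F` on a triangulation `T`: the lower limit, as `α → ∞`,
of the sum of `F` over the `d`-simplices of `T` contained in the closed ball of radius `α`
about the origin, divided by the volume of that ball. -/
def density (d : ℕ) (F : Finset (EuclideanSpace ℝ (Fin d)) → ℝ)
    (T : Geometry.SimplicialComplex ℝ (EuclideanSpace ℝ (Fin d))) : ℝ :=
  Filter.liminf (fun α : ℝ =>
    (∑ᶠ s ∈ {s : Finset (EuclideanSpace ℝ (Fin d)) |
        s ∈ T.faces ∧ s.card = d + 1 ∧
          (s : Set (EuclideanSpace ℝ (Fin d))) ⊆ Metric.closedBall 0 α},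
      F s) /
    (MeasureTheory.volume (Metric.closedBall (0 : EuclideanSpace ℝ (Fin d)) α)).toReal)
    Filter.atTop

/-- `X` is generic: no `d+2` points of `X` lie on a common `(d-1)`-sphere. -/
def Generic (d : ℕ) (X : Set (EuclideanSpace ℝ (Fin d))) : Prop :=
  ∀ Y : Finset (EuclideanSpace ℝ (Fin d)), ↑Y ⊆ X →
    (∃ c ρ, ∀ y ∈ Y, dist y c = ρ) → Y.card ≤ d + 1

/-- The simplex with vertex set `s` is empty with respect to `X`: the open ball bounded by
a sphere through all vertices of `s` contains no point of `X`. -/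
def EmptySimplex (d : ℕ) (s : Finset (EuclideanSpace ℝ (Fin d)))
    (X : Set (EuclideanSpace ℝ (Fin d))) : Prop :=
  ∃ c ρ, (∀ v ∈ s, dist v c = ρ) ∧ ∀ x ∈ X, ρ ≤ dist x c

/-- `D` is a Delaunay triangulation of `X`: a triangulation all of whose `d`-simplices
are empty. -/
def IsDelaunayTriangulation (d : ℕ)
    (D : Geometry.SimplicialComplex ℝ (EuclideanSpace ℝ (Fin d)))
    (X : Set (EuclideanSpace ℝ (Fin d))) : Prop :=
  IsTriangulationOf d D X ∧ ∀ s ∈ D.faces, s.card = d + 1 → EmptySimplex d s X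

/-- A set with at most one point in each ball of radius `r` meets every ball in a finite set. -/
theorem finite_inter_closedBall {X : Set (EuclideanSpace ℝ (Fin 2))} {r : ℝ} (hr : 0 < r)
    (hX : ∀ z : EuclideanSpace ℝ (Fin 2), (X ∩ ball z r).Subsingleton)
    (c : EuclideanSpace ℝ (Fin 2)) (α : ℝ) : (X ∩ closedBall c α).Finite := by
  obtain ⟨t, ht, hcov⟩ := Metric.totallyBounded_iff.1
    (isCompact_closedBall c α).totallyBounded r hr
  refine (ht.biUnion fun y _ => (hX y).finite).subset ?_
  rintro x ⟨hx, hxc⟩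
  obtain ⟨y, hy, hxy⟩ := Set.mem_iUnion₂.1 (hcov hxc)
  exact Set.mem_iUnion₂.2 ⟨y, hy, hx, hxy⟩

/-- Every point of the plane lies in the convex hull of an empty simplex of a locally finite,
relatively dense set. -/
theorem exists_emptySimplex_mem_convexHull {X : Set (EuclideanSpace ℝ (Fin 2))} {R : ℝ}
    (hfin : ∀ (c : EuclideanSpace ℝ (Fin 2)) (α : ℝ), (X ∩ closedBall c α).Finite)
    (hR : ∀ z : EuclideanSpace ℝ (Fin 2), (X ∩ closedBall z R).Nonempty)
    (z : EuclideanSpace ℝ (Fin 2)) :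
    ∃ A : Finset (EuclideanSpace ℝ (Fin 2)), ↑A ⊆ X ∧ EmptySimplex 2 A X ∧
      z ∈ convexHull ℝ (A : Set (EuclideanSpace ℝ (Fin 2))) := by
  have hne : X.Nonempty := (hR z).mono Set.inter_subset_left
  have hR0 : 0 ≤ R := by
    obtain ⟨x, -, hx⟩ := hR z
    exact dist_nonneg.trans hx
  have hinf : ∀ c, infDist c X ≤ R := fun c => by
    obtain ⟨x, hx, hxc⟩ := hR c
    exact (infDist_le_dist_of_mem hx).trans (by rwa [dist_comm])
  have hatt : ∀ c, ∃ x ∈ X, dist x c = infDist c X := fun c => by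
    have hK : IsCompact (X ∩ closedBall c R) := (hfin c R).isCompact
    obtain ⟨x, hx, hmin⟩ := hK.exists_isMinOn (hR c)
      (continuous_id.dist continuous_const : Continuous fun x => dist x c).continuousOn
    refine ⟨x, hx.1, le_antisymm ?_ (by rw [dist_comm]; exact infDist_le_dist_of_mem hx.1)⟩
    refine (le_infDist hne).2 fun y hy => ?_
    by_cases hyc : dist y c ≤ R
    · rw [dist_comm c y]; exact hmin ⟨hy, hyc⟩
    · rw [dist_comm c y]; exact le_trans hx.2 (not_le.1 hyc).le
  set φ : EuclideanSpace ℝ (Fin 2) → ℝ := fun c => infDist c X ^ 2 - dist z c ^ 2 with hφ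
  have hφc : Continuous φ :=
    ((continuous_infDist_pt X).pow 2).sub ((continuous_const.dist continuous_id).pow 2)
  obtain ⟨c, hc, hmax⟩ := (isCompact_closedBall z R).exists_isMaxOn
    ⟨z, mem_closedBall_self hR0⟩ hφc.continuousOn
  have hmax' : ∀ y, φ y ≤ φ c := fun y => by
    by_cases hy : y ∈ closedBall z R
    · exact hmax hy
    · have h1 : R < dist z y := by rw [dist_comm]; simpa using hy
      have h2 : φ z ≤ φ c := hmax (mem_closedBall_self hR0)
      have h3 : 0 ≤ φ z := by simp [hφ]; positivity
      have h4 : φ y ≤ 0 := by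
        have := hinf y
        have := infDist_nonneg (x := y) (s := X)
        simp only [hφ]; nlinarith
      linarith
  have hAfin : {x ∈ X | dist x c = infDist c X}.Finite :=
    (hfin c (infDist c X)).subset fun x hx => ⟨hx.1, hx.2.le⟩
  refine ⟨hAfin.toFinset, by intro x hx; simp at hx; exact hx.1,
    ⟨c, infDist c X, fun v hv => by simp at hv; exact hv.2,
      fun x hx => by rw [dist_comm]; exact infDist_le_dist_of_mem hx⟩, ?_⟩
  by_contra hz
  rw [Set.Finite.coe_toFinset] at hz
  obtain ⟨f, u, hfz, hfu⟩ := geometric_hahn_banach_point_closed (convex_convexHull ℝ _)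
    (hAfin.isCompact_convexHull (𝕜 := ℝ)).isClosed hz
  set w := (InnerProductSpace.toDual ℝ (EuclideanSpace ℝ (Fin 2))).symm f with hw
  have hfw : ∀ x, f x = inner ℝ w x := fun x => by simp [hw]
  have hexp : ∀ (t : ℝ) (x : EuclideanSpace ℝ (Fin 2)),
      dist x (c - t • w) ^ 2 - dist z (c - t • w) ^ 2 =
        dist x c ^ 2 - dist z c ^ 2 + 2 * t * (f x - f z) := fun t x => by
    have e : ∀ y : EuclideanSpace ℝ (Fin 2), dist y (c - t • w) ^ 2 =
        dist y c ^ 2 + 2 * t * (f y - f c) + ‖t • w‖ ^ 2 := fun y => by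
      rw [dist_eq_norm, dist_eq_norm, show y - (c - t • w) = (y - c) + t • w by abel,
        norm_add_sq_real, inner_smul_right, real_inner_comm, inner_sub_right, hfw, hfw]
      ring
    rw [e, e]; ring
  have hev : ∀ x ∈ X ∩ closedBall c (R + 1), ∀ᶠ t : ℝ in nhdsWithin 0 (Set.Ioi 0),
      φ c < dist x (c - t • w) ^ 2 - dist z (c - t • w) ^ 2 := by
    rintro x ⟨hx, -⟩
    by_cases hxA : dist x c = infDist c X
    · filter_upwards [self_mem_nhdsWithin] with t (ht : 0 < t)
      rw [hexp, hxA]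
      have := hfu x (subset_convexHull ℝ _ ⟨hx, hxA⟩)
      have : 0 < 2 * t * (f x - f z) := by
        apply mul_pos (by linarith); linarith
      simp only [hφ]; linarith
    · have hlt : infDist c X < dist x c := lt_of_le_of_ne
        (by rw [dist_comm]; exact infDist_le_dist_of_mem hx) (Ne.symm hxA)
      have hcont : Continuous fun t : ℝ =>
          dist x (c - t • w) ^ 2 - dist z (c - t • w) ^ 2 := by fun_prop
      refine nhdsWithin_le_nhds (hcont.continuousAt.eventually (lt_mem_nhds ?_))
      simp only [zero_smul, sub_zero, hφ]
      have := infDist_nonneg (x := c) (s := X)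
      nlinarith
  have hsmall : ∀ᶠ t : ℝ in nhdsWithin 0 (Set.Ioi 0), ‖t • w‖ < 1 := by
    have hcont : Continuous fun t : ℝ => ‖t • w‖ := by fun_prop
    refine nhdsWithin_le_nhds (hcont.continuousAt.eventually (gt_mem_nhds ?_))
    simp
  obtain ⟨t, ht, hts⟩ := (((Set.Finite.eventually_all (hfin c (R + 1))).2 hev).and hsmall).exists
  obtain ⟨x, hx, hxe⟩ := hatt (c - t • w)
  have hxc : dist x c ≤ R + 1 := by
    have h1 := dist_triangle x (c - t • w) c
    have h2 : dist (c - t • w) c = ‖t • w‖ := by simp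
    have h3 := hinf (c - t • w)
    linarith
  have h1 := ht x ⟨hx, hxc⟩
  have h2 := hmax' (c - t • w)
  rw [hxe] at h1
  exact absurd h1 (not_lt.2 h2)

/-- A point of a convex hull at which a linear functional attains its maximum over the vertices
lies in the convex hull of the maximizing vertices. -/
theorem mem_convexHull_of_isMax {s : Finset (EuclideanSpace ℝ (Fin 2))}
    (f : EuclideanSpace ℝ (Fin 2) →ₗ[ℝ] ℝ) {m : ℝ} (hf : ∀ v ∈ s, f v ≤ m)
    {z : EuclideanSpace ℝ (Fin 2)} (hz : z ∈ convexHull ℝ (s : Set (EuclideanSpace ℝ (Fin 2))))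
    (hfz : m ≤ f z) : z ∈ convexHull ℝ {v | v ∈ s ∧ f v = m} := by
  classical
  obtain ⟨w, hw0, hw1, hwz⟩ := Finset.mem_convexHull'.1 hz
  have hnn : ∀ v ∈ s, 0 ≤ w v * (m - f v) := fun v hv =>
    mul_nonneg (hw0 v hv) (sub_nonneg.2 (hf v hv))
  have hsum : ∑ v ∈ s, w v * (m - f v) = m - f z := by
    rw [← hwz, map_sum]
    simp only [mul_sub, Finset.sum_sub_distrib, ← Finset.sum_mul, hw1, one_mul, map_smul,
      smul_eq_mul]
  have hzero : ∀ v ∈ s, w v * (m - f v) = 0 :=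
    (Finset.sum_eq_zero_iff_of_nonneg hnn).1
      (le_antisymm (by rw [hsum]; linarith) (Finset.sum_nonneg hnn))
  have hfilt : ∀ v ∈ s, w v ≠ 0 → f v = m := fun v hv hwv => by
    rcases mul_eq_zero.1 (hzero v hv) with h | h
    · exact absurd h hwv
    · linarith
  have : ({v | v ∈ s ∧ f v = m} : Set (EuclideanSpace ℝ (Fin 2))) =
      ((s.filter fun v => f v = m : Finset _) : Set _) := by ext; simp
  rw [this, Finset.mem_convexHull']
  refine ⟨w, fun v hv => hw0 v (Finset.mem_filter.1 hv).1, ?_, ?_⟩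
  · rw [Finset.sum_filter_of_ne hfilt, hw1]
  · rw [Finset.sum_filter_of_ne, hwz]
    intro v hv hne
    exact hfilt v hv fun h => hne (by rw [h, zero_smul])

/-- At most three distinct cocircular points are affinely independent. -/
theorem affineIndependent_of_cocircular {s : Finset (EuclideanSpace ℝ (Fin 2))}
    (hs : s.card ≤ 3) (hc : ∃ c ρ, ∀ v ∈ s, dist v c = ρ) :
    AffineIndependent ℝ ((↑) : s → EuclideanSpace ℝ (Fin 2)) := by
  obtain ⟨c, ρ, hc⟩ := hc
  have hrange : ∀ {n : ℕ} (p : Fin n → EuclideanSpace ℝ (Fin 2)),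
      AffineIndependent ℝ p → Set.range p = (s : Set (EuclideanSpace ℝ (Fin 2))) →
      AffineIndependent ℝ ((↑) : s → EuclideanSpace ℝ (Fin 2)) := by
    intro n p hp hr
    have := hp.range
    rw [hr] at this
    exact this
  rcases Nat.lt_or_ge s.card 2 with h | h
  · have : Subsingleton s :=
      Finset.card_le_one_iff_subsingleton_coe.1 (Nat.lt_succ_iff.1 h)
    exact affineIndependent_of_subsingleton ℝ _
  rcases Nat.lt_or_ge s.card 3 with h' | h'
  · obtain ⟨x, y, hxy, rfl⟩ := Finset.card_eq_two.1 (by omega : s.card = 2)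
    exact hrange _ (affineIndependent_of_ne ℝ hxy) (by simp [Set.pair_comm])
  · obtain ⟨x, y, z, hxy, hxz, hyz, rfl⟩ := Finset.card_eq_three.1 (by omega : s.card = 3)
    refine hrange ![x, y, z]
      (EuclideanGeometry.Cospherical.affineIndependent_of_ne ⟨c, ρ, ?_⟩ hxy hxz hyz) ?_
    · simpa using hc
    · ext v
      simp only [Matrix.range_cons, Matrix.range_empty, Finset.coe_insert, Finset.coe_singleton,
        Set.mem_union, Set.mem_insert_iff, Set.mem_singleton_iff, Set.mem_empty_iff_false, or_false]

/-- Two empty simplices of a generic set meet in a common face. -/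
theorem convexHull_inter_subset_of_emptySimplex {X : Set (EuclideanSpace ℝ (Fin 2))}
    (hX : Generic 2 X) {s t : Finset (EuclideanSpace ℝ (Fin 2))} (hs : ↑s ⊆ X) (ht : ↑t ⊆ X)
    (hse : EmptySimplex 2 s X) (hte : EmptySimplex 2 t X) :
    convexHull ℝ (s : Set (EuclideanSpace ℝ (Fin 2))) ∩ convexHull ℝ ↑t ⊆
      convexHull ℝ (↑s ∩ ↑t) := by
  classical
  rintro z ⟨hzs, hzt⟩
  obtain ⟨c, ρ, hc, hcX⟩ := hse
  obtain ⟨c', ρ', hc', hcX'⟩ := hte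
  obtain ⟨v₀, hv₀⟩ : s.Nonempty := by simpa using convexHull_nonempty_iff.1 ⟨z, hzs⟩
  obtain ⟨v₁, hv₁⟩ : t.Nonempty := by simpa using convexHull_nonempty_iff.1 ⟨z, hzt⟩
  have hρ : 0 ≤ ρ := hc v₀ hv₀ ▸ dist_nonneg
  have hρ' : 0 ≤ ρ' := hc' v₁ hv₁ ▸ dist_nonneg
  set f : EuclideanSpace ℝ (Fin 2) →ₗ[ℝ] ℝ :=
    (innerₗ (EuclideanSpace ℝ (Fin 2)) (c' - c)) with hf
  set m : ℝ := (ρ ^ 2 - ‖c‖ ^ 2 - ρ' ^ 2 + ‖c'‖ ^ 2) / 2 with hm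
  have hfv : ∀ v, f v = (dist v c ^ 2 - ‖c‖ ^ 2 - dist v c' ^ 2 + ‖c'‖ ^ 2) / 2 := fun v => by
    rw [dist_eq_norm, dist_eq_norm, norm_sub_sq_real, norm_sub_sq_real, hf, innerₗ_apply_apply,
      inner_sub_left, real_inner_comm c', real_inner_comm c]
    ring
  have hfs : ∀ v ∈ s, f v ≤ m := fun v hv => by
    have := hcX' v (hs hv)
    rw [hfv, hc v hv]; simp only [hm]; nlinarith
  have hft : ∀ v ∈ t, (-f) v ≤ -m := fun v hv => by
    have := hcX v (ht hv)
    rw [LinearMap.neg_apply, hfv, hc' v hv]; simp only [hm]; nlinarith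
  have hcs : ∀ {g : EuclideanSpace ℝ (Fin 2) →ₗ[ℝ] ℝ} {k : ℝ}
      {u : Finset (EuclideanSpace ℝ (Fin 2))}, (∀ v ∈ u, g v ≤ k) → z ∈ convexHull ℝ ↑u →
      g z ≤ k := fun {g k u} h hz =>
    convexHull_min (fun v hv => h v hv) (convex_halfSpace_le g.isLinear k) hz
  have h1 := hcs hfs hzs
  have h2 := hcs hft hzt
  rw [LinearMap.neg_apply] at h2
  have hz1 := mem_convexHull_of_isMax f hfs hzs (by linarith)
  have hz2 := mem_convexHull_of_isMax (-f) hft hzt (by rw [LinearMap.neg_apply]; linarith)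
  set s' := s.filter fun v => f v = m
  set t' := t.filter fun v => f v = m
  have es : ({v | v ∈ s ∧ f v = m} : Set (EuclideanSpace ℝ (Fin 2))) = (s' : Set _) := by
    ext; simp [s']
  have et : ({v | v ∈ t ∧ (-f) v = -m} : Set (EuclideanSpace ℝ (Fin 2))) = (t' : Set _) := by
    ext; simp [t']
  rw [es] at hz1
  rw [et] at hz2
  have hcirc : ∀ v ∈ s' ∪ t', dist v c = ρ := fun v hv => by
    rcases Finset.mem_union.1 hv with h | h
    · exact hc v (Finset.mem_filter.1 h).1
    · obtain ⟨h, hm'⟩ := Finset.mem_filter.1 h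
      rw [hfv, hc' v h] at hm'
      have : dist v c ^ 2 = ρ ^ 2 := by simp only [hm] at hm'; linarith
      exact (pow_left_inj₀ dist_nonneg hρ two_ne_zero).1 this
  have hsub : ((s' ∪ t' : Finset _) : Set (EuclideanSpace ℝ (Fin 2))) ⊆ X := fun v hv => by
    rcases Finset.mem_union.1 (Finset.mem_coe.1 hv) with h | h
    · exact hs (Finset.mem_filter.1 h).1
    · exact ht (Finset.mem_filter.1 h).1
  have hind := affineIndependent_of_cocircular (hX _ hsub ⟨c, ρ, hcirc⟩) ⟨c, ρ, hcirc⟩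
  have hz : z ∈ convexHull ℝ ((s' ∩ t' : Finset _) : Set (EuclideanSpace ℝ (Fin 2))) := by
    have := hind.convexHull_inter' (t₁ := s') (t₂ := t')
    rw [Finset.coe_inter, this]
    exact ⟨hz1, hz2⟩
  refine convexHull_mono ?_ hz
  intro v hv
  rw [Finset.mem_coe, Finset.mem_inter, Finset.mem_filter, Finset.mem_filter] at hv
  exact ⟨hv.1.1, hv.2.1⟩

/-- The Delaunay complex of a generic set: its faces are all empty simplices. -/
def delaunayComplex (X : Set (EuclideanSpace ℝ (Fin 2))) (hX : Generic 2 X) :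
    Geometry.SimplicialComplex ℝ (EuclideanSpace ℝ (Fin 2)) where
  faces := {s | s.Nonempty ∧ ↑s ⊆ X ∧ EmptySimplex 2 s X}
  isRelLowerSet_faces := by
    rintro s ⟨hs, hsX, c, ρ, hc, hcX⟩
    refine ⟨hs, fun t hts ht => ⟨ht, fun v hv => hsX (hts hv), c, ρ, fun v hv => hc v (hts hv),
      hcX⟩⟩
  indep := by
    rintro s ⟨-, hsX, c, ρ, hc, -⟩
    exact affineIndependent_of_cocircular (hX s hsX ⟨c, ρ, hc⟩) ⟨c, ρ, hc⟩
  inter_subset_convexHull := fun hs ht =>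
    convexHull_inter_subset_of_emptySimplex hX hs.2.1 ht.2.1 hs.2.2 ht.2.2

theorem isDelaunayTriangulation_delaunayComplex {X : Set (EuclideanSpace ℝ (Fin 2))}
    (hX : Generic 2 X) {R : ℝ}
    (hfin : ∀ (c : EuclideanSpace ℝ (Fin 2)) (α : ℝ), (X ∩ closedBall c α).Finite)
    (hR : ∀ z : EuclideanSpace ℝ (Fin 2), (X ∩ closedBall z R).Nonempty) :
    IsDelaunayTriangulation 2 (delaunayComplex X hX) X := by
  refine ⟨⟨?_, ?_⟩, fun s hs _ => hs.2.2⟩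
  · ext x
    rw [Geometry.SimplicialComplex.mem_vertices]
    constructor
    · intro h
      exact h.2.1 (by simp)
    · intro h
      exact ⟨by simp, by simpa using h, x, 0, by simp, fun y _ => dist_nonneg⟩
  · rw [Set.eq_univ_iff_forall]
    intro z
    obtain ⟨A, hA, hAe, hz⟩ := exists_emptySimplex_mem_convexHull hfin hR z
    rw [Geometry.SimplicialComplex.mem_space_iff]
    refine ⟨A, ⟨?_, hA, hAe⟩, hz⟩
    simpa using convexHull_nonempty_iff.1 ⟨z, hz⟩

/-- A finite set with at most two points has its convex hull inside a segment. -/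
theorem exists_mem_segment_of_card_le_two {s : Finset (EuclideanSpace ℝ (Fin 2))}
    (hs : s.card ≤ 2) {z : EuclideanSpace ℝ (Fin 2)}
    (hz : z ∈ convexHull ℝ (s : Set (EuclideanSpace ℝ (Fin 2)))) :
    ∃ x ∈ s, ∃ y ∈ s, z ∈ segment ℝ x y := by
  have hne : s.Nonempty := by simpa using convexHull_nonempty_iff.1 ⟨z, hz⟩
  have := hne.card_pos
  rcases Nat.lt_or_ge s.card 2 with h | h
  · obtain ⟨x, rfl⟩ := Finset.card_eq_one.1 (by omega : s.card = 1)
    exact ⟨x, by simp, x, by simp, by simpa using hz⟩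
  · obtain ⟨x, y, -, rfl⟩ := Finset.card_eq_two.1 (by omega : s.card = 2)
    refine ⟨x, by simp, y, by simp, ?_⟩
    simpa [convexHull_pair] using hz

/-- A point that lies on no segment spanned by `X` is in at most one empty triangle. -/
theorem eq_of_mem_convexHull_of_emptySimplex {X : Set (EuclideanSpace ℝ (Fin 2))}
    (hX : Generic 2 X) {s t : Finset (EuclideanSpace ℝ (Fin 2))} (hs : ↑s ⊆ X) (ht : ↑t ⊆ X)
    (hs3 : s.card = 3) (ht3 : t.card = 3)
    (hse : EmptySimplex 2 s X) (hte : EmptySimplex 2 t X) {z : EuclideanSpace ℝ (Fin 2)}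
    (hz : ∀ x ∈ X, ∀ y ∈ X, z ∉ segment ℝ x y) (hzs : z ∈ convexHull ℝ ↑s)
    (hzt : z ∈ convexHull ℝ ↑t) : s = t := by
  classical
  have h := convexHull_inter_subset_of_emptySimplex hX hs ht hse hte ⟨hzs, hzt⟩
  rw [← Finset.coe_inter] at h
  have hcard : 3 ≤ (s ∩ t).card := by
    by_contra hlt
    obtain ⟨x, hx, y, hy, hxy⟩ := exists_mem_segment_of_card_le_two (by omega) h
    exact hz x (hs (Finset.mem_inter.1 hx).1) y (hs (Finset.mem_inter.1 hy).1) hxy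
  have h1 := Finset.eq_of_subset_of_card_le (Finset.inter_subset_left : s ∩ t ⊆ s) (by omega)
  have h2 := Finset.eq_of_subset_of_card_le (Finset.inter_subset_right : s ∩ t ⊆ t) (by omega)
  rw [← h1, h2]

/-- A nonempty open set contains a point on no segment spanned by a countable set. -/
theorem exists_mem_forall_notMem_segment {X U : Set (EuclideanSpace ℝ (Fin 2))}
    (hX : X.Countable) (hU : IsOpen U) (hne : U.Nonempty) :
    ∃ z ∈ U, ∀ x ∈ X, ∀ y ∈ X, z ∉ segment ℝ x y := by
  have hnull : ∀ x y : EuclideanSpace ℝ (Fin 2), volume (segment ℝ x y) = 0 := fun x y => by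
    have hle : segment ℝ x y ⊆ (line[ℝ, x, y] : Set (EuclideanSpace ℝ (Fin 2))) := by
      rw [← convexHull_pair]
      exact convexHull_subset_affineSpan _
    refine measure_mono_null hle (Measure.addHaar_affineSubspace _ _ fun htop => ?_)
    have h1 := finrank_vectorSpan_insert_le_set ℝ {y} x
    rw [← direction_affineSpan, htop, AffineSubspace.direction_top, finrank_top] at h1
    simp at h1
  have hB : volume (⋃ x ∈ X, ⋃ y ∈ X, segment ℝ x y) = 0 :=
    (measure_biUnion_null_iff hX).2 fun x _ => (measure_biUnion_null_iff hX).2 fun y _ => hnull x y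
  by_contra! h
  refine (hU.measure_pos volume hne).ne' (measure_mono_null (fun z hz => ?_) hB)
  obtain ⟨x, hx, y, hy, hxy⟩ := h z hz
  exact Set.mem_iUnion₂.2 ⟨x, hx, Set.mem_iUnion₂.2 ⟨y, hy, hxy⟩⟩

/-- A point on no segment spanned by `X` lies in an empty triangle. -/
theorem exists_emptyTriangle_mem_convexHull {X : Set (EuclideanSpace ℝ (Fin 2))} {R : ℝ}
    (hX : Generic 2 X)
    (hfin : ∀ (c : EuclideanSpace ℝ (Fin 2)) (α : ℝ), (X ∩ closedBall c α).Finite)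
    (hR : ∀ z : EuclideanSpace ℝ (Fin 2), (X ∩ closedBall z R).Nonempty)
    {z : EuclideanSpace ℝ (Fin 2)} (hz : ∀ x ∈ X, ∀ y ∈ X, z ∉ segment ℝ x y) :
    ∃ A : Finset (EuclideanSpace ℝ (Fin 2)), ↑A ⊆ X ∧ A.card = 3 ∧ EmptySimplex 2 A X ∧
      z ∈ convexHull ℝ (A : Set (EuclideanSpace ℝ (Fin 2))) := by
  obtain ⟨A, hA, hAe, hzA⟩ := exists_emptySimplex_mem_convexHull hfin hR z
  refine ⟨A, hA, ?_, hAe, hzA⟩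
  have h1 : A.card ≤ 3 := by
    obtain ⟨c, ρ, hc, -⟩ := hAe
    exact hX A hA ⟨c, ρ, hc⟩
  have h2 : ¬ A.card ≤ 2 := fun h => by
    obtain ⟨x, hx, y, hy, hxy⟩ := exists_mem_segment_of_card_le_two h hzA
    exact hz x (hA hx) y (hA hy) hxy
  omega

/-- The convex hull of a cocircular triangle has nonempty interior. -/
theorem interior_convexHull_nonempty_of_cocircular {s : Finset (EuclideanSpace ℝ (Fin 2))}
    (hs : s.card = 3) (hc : ∃ c ρ, ∀ v ∈ s, dist v c = ρ) :
    (interior (convexHull ℝ (s : Set (EuclideanSpace ℝ (Fin 2))))).Nonempty := by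
  rw [interior_convexHull_nonempty_iff_affineSpan_eq_top]
  have := affineIndependent_of_cocircular hs.le hc
  have h2 := this.affineSpan_eq_top_iff_card_eq_finrank_add_one.2 (by simp [hs])
  simpa using h2

theorem EmptySimplex.mono {s : Finset (EuclideanSpace ℝ (Fin 2))}
    {X Y : Set (EuclideanSpace ℝ (Fin 2))} (h : EmptySimplex 2 s X) (hYX : Y ⊆ X) :
    EmptySimplex 2 s Y := by
  obtain ⟨c, ρ, hc, hX⟩ := h
  exact ⟨c, ρ, hc, fun x hx => hX x (hYX hx)⟩

theorem Generic.mono {X Y : Set (EuclideanSpace ℝ (Fin 2))} (h : Generic 2 X) (hYX : Y ⊆ X) :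
    Generic 2 Y := fun s hs => h s (hs.trans hYX)

theorem countable_of_finite_inter_closedBall {X : Set (EuclideanSpace ℝ (Fin 2))}
    (hfin : ∀ (c : EuclideanSpace ℝ (Fin 2)) (α : ℝ), (X ∩ closedBall c α).Finite) :
    X.Countable := by
  have : X = ⋃ n : ℕ, X ∩ closedBall 0 (n : ℝ) := by
    rw [← Set.inter_iUnion, iUnion_closedBall_nat, Set.inter_univ]
  rw [this]
  exact Set.countable_iUnion fun n => (hfin 0 n).countable

/-- The triangles with vertices in `X` whose circumdisk is empty. -/
def emptyTriangles (X : Set (EuclideanSpace ℝ (Fin 2))) :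
    Set (Finset (EuclideanSpace ℝ (Fin 2))) :=
  {s | s.card = 3 ∧ ↑s ⊆ X ∧ EmptySimplex 2 s X}

/-- If the triangles of `T₁` cover a neighbourhood of every added point and are covered by the
triangles of `T₀`, then adding the points replaces `T₀` by `T₁` and changes no other triangle. -/
theorem emptyTriangles_diff_eq {X Y : Set (EuclideanSpace ℝ (Fin 2))} {R : ℝ}
    (hX : Generic 2 X) (hYX : Y ⊆ X)
    (hfin : ∀ (c : EuclideanSpace ℝ (Fin 2)) (α : ℝ), (X ∩ closedBall c α).Finite)
    (hR : ∀ z : EuclideanSpace ℝ (Fin 2), (Y ∩ closedBall z R).Nonempty)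
    {T₀ T₁ : Set (Finset (EuclideanSpace ℝ (Fin 2)))}
    (h₀ : T₀ ⊆ emptyTriangles Y \ emptyTriangles X)
    (h₁ : T₁ ⊆ emptyTriangles X \ emptyTriangles Y)
    (hcov : ∀ s ∈ T₁, ∀ z ∈ convexHull ℝ (s : Set (EuclideanSpace ℝ (Fin 2))),
      ∃ s' ∈ T₀, z ∈ convexHull ℝ (s' : Set (EuclideanSpace ℝ (Fin 2))))
    (hnhds : ∀ q ∈ X \ Y, ∀ᶠ z in nhds q,
      ∃ s ∈ T₁, z ∈ convexHull ℝ (s : Set (EuclideanSpace ℝ (Fin 2)))) :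
    emptyTriangles Y \ emptyTriangles X = T₀ ∧ emptyTriangles X \ emptyTriangles Y = T₁ := by
  have hcount := countable_of_finite_inter_closedBall hfin
  have hRX : ∀ z : EuclideanSpace ℝ (Fin 2), (X ∩ closedBall z R).Nonempty :=
    fun z => (hR z).mono (Set.inter_subset_inter_left _ hYX)
  have huniq : ∀ {W : Set (EuclideanSpace ℝ (Fin 2))}, W ⊆ X → ∀ {s t z},
      s ∈ emptyTriangles W → t ∈ emptyTriangles W →
      (∀ x ∈ X, ∀ y ∈ X, z ∉ segment ℝ x y) →
      z ∈ convexHull ℝ (s : Set (EuclideanSpace ℝ (Fin 2))) →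
      z ∈ convexHull ℝ (t : Set (EuclideanSpace ℝ (Fin 2))) → s = t :=
    fun {W} hW {s t z} hs ht hz hzs hzt =>
      eq_of_mem_convexHull_of_emptySimplex (hX.mono hW) hs.2.1 ht.2.1 hs.1 ht.1 hs.2.2 ht.2.2
        (fun x hx y hy => hz x (hW hx) y (hW hy)) hzs hzt
  have hinterior : ∀ {W : Set (EuclideanSpace ℝ (Fin 2))} {s}, s ∈ emptyTriangles W →
      (interior (convexHull ℝ (s : Set (EuclideanSpace ℝ (Fin 2))))).Nonempty :=
    fun {W s} hs => interior_convexHull_nonempty_of_cocircular hs.1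
      (by obtain ⟨c, ρ, hc, -⟩ := hs.2.2; exact ⟨c, ρ, hc⟩)
  have key₁ : emptyTriangles X \ emptyTriangles Y ⊆ T₁ := by
    rintro s ⟨hs, hsY⟩
    have hns : ¬ (↑s ⊆ Y) := fun h => hsY ⟨hs.1, h, hs.2.2.mono hYX⟩
    obtain ⟨q, hqs, hqY⟩ := Set.not_subset.1 hns
    obtain ⟨U, hUT, hUo, hqU⟩ := _root_.eventually_nhds_iff.1 (hnhds q ⟨hs.2.1 hqs, hqY⟩)
    have hqcl : q ∈ closure (interior (convexHull ℝ (s : Set (EuclideanSpace ℝ (Fin 2))))) := by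
      rw [(convex_convexHull ℝ _).closure_interior_eq_closure_of_nonempty_interior (hinterior hs)]
      exact subset_closure (subset_convexHull ℝ _ hqs)
    obtain ⟨z, ⟨hzU, hzs⟩, hz⟩ := exists_mem_forall_notMem_segment hcount
      (hUo.inter isOpen_interior) (mem_closure_iff.1 hqcl _ hUo hqU)
    obtain ⟨s', hs', hzs'⟩ := hUT z hzU
    rw [huniq subset_rfl hs (h₁ hs').1 hz (interior_subset hzs) hzs']
    exact hs'
  have key₀ : emptyTriangles Y \ emptyTriangles X ⊆ T₀ := by
    rintro s ⟨hs, hsX⟩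
    obtain ⟨z, hzs, hz⟩ := exists_mem_forall_notMem_segment hcount isOpen_interior (hinterior hs)
    have hzs := interior_subset hzs
    obtain ⟨A, hA, hA3, hAe, hzA⟩ := exists_emptyTriangle_mem_convexHull hX hfin hRX hz
    by_cases hAY : A ∈ emptyTriangles Y
    · exact absurd ⟨hA3, hA, hAe⟩ (huniq hYX hs hAY hz hzs hzA ▸ hsX)
    · obtain ⟨s', hs', hzs'⟩ := hcov A (key₁ ⟨⟨hA3, hA, hAe⟩, hAY⟩) z hzA
      rw [huniq hYX hs (h₀ hs').1 hz hzs hzs']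
      exact hs'
  exact ⟨key₀.antisymm h₀, key₁.antisymm h₁⟩

/-- The finite sets contained in the closed ball of radius `α` about the origin. -/
def insideBall (α : ℝ) : Set (Finset (EuclideanSpace ℝ (Fin 2))) :=
  {s | (s : Set (EuclideanSpace ℝ (Fin 2))) ⊆ closedBall 0 α}

/-- The triangle sum over `B_α` appearing in the definition of the limit density. -/
theorem finsum_delaunayComplex {X : Set (EuclideanSpace ℝ (Fin 2))} (hX : Generic 2 X)
    (F : Finset (EuclideanSpace ℝ (Fin 2)) → ℝ) (α : ℝ) :
    (∑ᶠ s ∈ {s : Finset (EuclideanSpace ℝ (Fin 2)) |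
        s ∈ (delaunayComplex X hX).faces ∧ s.card = 3 ∧
          (s : Set (EuclideanSpace ℝ (Fin 2))) ⊆ closedBall 0 α}, F s) =
      ∑ᶠ s ∈ emptyTriangles X ∩ insideBall α, F s := by
  refine finsum_mem_congr (Set.ext fun s => ⟨?_, ?_⟩) fun _ _ => rfl
  · rintro ⟨⟨-, h1, h2⟩, h3, h4⟩
    exact ⟨⟨h3, h1, h2⟩, h4⟩
  · rintro ⟨⟨h3, h1, h2⟩, h4⟩
    exact ⟨⟨Finset.card_pos.1 (by omega), h1, h2⟩, h3, h4⟩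

theorem finite_emptyTriangles_inter {X : Set (EuclideanSpace ℝ (Fin 2))}
    (hfin : ∀ (c : EuclideanSpace ℝ (Fin 2)) (α : ℝ), (X ∩ closedBall c α).Finite) (α : ℝ) :
    (emptyTriangles X ∩ insideBall α).Finite := by
  refine ((hfin 0 α).finite_subsets.preimage
    (Finset.coe_injective.injOn (s := Set.univ) |>.mono (Set.subset_univ _))).subset ?_
  rintro s ⟨hs, hα⟩
  exact Set.subset_inter hs.2.1 hα

/-- The image of a finite set under translation by `v`. -/
def translateFinset (v : EuclideanSpace ℝ (Fin 2)) (s : Finset (EuclideanSpace ℝ (Fin 2))) :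
    Finset (EuclideanSpace ℝ (Fin 2)) :=
  s.map (IsometryEquiv.addLeft v).toEquiv.toEmbedding

theorem mem_translateFinset {v x : EuclideanSpace ℝ (Fin 2)}
    {s : Finset (EuclideanSpace ℝ (Fin 2))} :
    x ∈ translateFinset v s ↔ ∃ y ∈ s, v + y = x := by
  simp only [translateFinset, Finset.mem_map, Equiv.coe_toEmbedding,
    IsometryEquiv.coe_toEquiv, IsometryEquiv.addLeft_apply]

open scoped Pointwise in
theorem coe_translateFinset (v : EuclideanSpace ℝ (Fin 2))
    (s : Finset (EuclideanSpace ℝ (Fin 2))) :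
    (translateFinset v s : Set (EuclideanSpace ℝ (Fin 2))) =
      v +ᵥ (s : Set (EuclideanSpace ℝ (Fin 2))) := by
  ext x
  simp [mem_translateFinset, Set.mem_vadd_set]

open scoped Pointwise in
theorem mem_convexHull_translateFinset {v z : EuclideanSpace ℝ (Fin 2)}
    {s : Finset (EuclideanSpace ℝ (Fin 2))} :
    z ∈ convexHull ℝ (translateFinset v s : Set (EuclideanSpace ℝ (Fin 2))) ↔
      z - v ∈ convexHull ℝ (s : Set (EuclideanSpace ℝ (Fin 2))) := by
  rw [coe_translateFinset, convexHull_vadd, Set.mem_vadd_set_iff_neg_vadd_mem, vadd_eq_add,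
    neg_add_eq_sub]

/-- Comparison of the two triangle sums when each of the added points replaces a translate of the
triangles `T₀` by the same translate of the triangles `T₁`. -/
theorem finsum_emptyTriangles_sub {ι : Type*} {X Y : Set (EuclideanSpace ℝ (Fin 2))}
    (hYX : Y ⊆ X)
    (hfin : ∀ (c : EuclideanSpace ℝ (Fin 2)) (α : ℝ), (X ∩ closedBall c α).Finite)
    {F : Finset (EuclideanSpace ℝ (Fin 2)) → ℝ} {pos : ι → EuclideanSpace ℝ (Fin 2)}
    (hF : ∀ g s, F (translateFinset (pos g) s) = F s)
    {S : Set ι} {T₀ T₁ : Finset (Finset (EuclideanSpace ℝ (Fin 2)))}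
    (h₀ : emptyTriangles Y \ emptyTriangles X =
      {s | ∃ g ∈ S, ∃ t ∈ T₀, translateFinset (pos g) t = s})
    (h₁ : emptyTriangles X \ emptyTriangles Y =
      {s | ∃ g ∈ S, ∃ t ∈ T₁, translateFinset (pos g) t = s})
    {α : ℝ} {A : Finset ι}
    (hA : ∀ g, ∀ t ∈ T₀ ∪ T₁, g ∈ A ↔ g ∈ S ∧ translateFinset (pos g) t ∈ insideBall α)
    (hinj : ∀ g g', ∀ t ∈ T₀ ∪ T₁, ∀ t' ∈ T₀ ∪ T₁,
      translateFinset (pos g) t = translateFinset (pos g') t' → g = g') :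
    (∑ᶠ s ∈ emptyTriangles X ∩ insideBall α, F s) -
      (∑ᶠ s ∈ emptyTriangles Y ∩ insideBall α, F s) =
      A.card * (∑ s ∈ T₁, F s - ∑ s ∈ T₀, F s) := by
  classical
  have hfinY : ∀ (c : EuclideanSpace ℝ (Fin 2)) (α : ℝ), (Y ∩ closedBall c α).Finite :=
    fun c α => (hfin c α).subset (Set.inter_subset_inter_left _ hYX)
  set B := insideBall α
  have key : ∀ (D D' : Set (Finset (EuclideanSpace ℝ (Fin 2))))
      (T : Finset (Finset (EuclideanSpace ℝ (Fin 2)))), T ⊆ T₀ ∪ T₁ →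
      D \ D' = {s | ∃ g ∈ S, ∃ t ∈ T, translateFinset (pos g) t = s} →
      ∑ᶠ s ∈ (D ∩ B) \ (D' ∩ B), F s = A.card * ∑ s ∈ T, F s := by
    intro D D' T hT h
    have hset : (D ∩ B) \ (D' ∩ B) =
        (((A ×ˢ T).image fun x => translateFinset (pos x.1) x.2 : Finset _) : Set _) := by
      have : (D ∩ B) \ (D' ∩ B) = (D \ D') ∩ B := by
        ext s; simp only [Set.mem_sdiff, Set.mem_inter_iff]; tauto
      rw [this, h]
      ext s
      simp only [Set.mem_inter_iff, Set.mem_ofPred_eq, Finset.coe_image, Set.mem_image,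
        Finset.mem_coe, Finset.mem_product, Prod.exists]
      constructor
      · rintro ⟨⟨g, hg, t, ht, rfl⟩, hB⟩
        exact ⟨g, t, ⟨(hA g t (hT ht)).2 ⟨hg, hB⟩, ht⟩, rfl⟩
      · rintro ⟨g, t, ⟨hg, ht⟩, rfl⟩
        have := (hA g t (hT ht)).1 hg
        exact ⟨⟨g, this.1, t, ht, rfl⟩, this.2⟩
    rw [hset, finsum_mem_coe_finset, Finset.sum_image, Finset.sum_product]
    · simp only [hF, Finset.sum_const, nsmul_eq_mul]
    · rintro ⟨g, t⟩ hx ⟨g', t'⟩ hx' heq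
      simp only [Finset.coe_product, Set.mem_prod, Finset.mem_coe] at hx hx' heq
      obtain rfl := hinj g g' t (hT hx.2) t' (hT hx'.2) heq
      have : t = t' := Finset.map_injective _ heq
      rw [this]
  have e₁ := key _ _ T₁ Finset.subset_union_right h₁
  have e₀ := key _ _ T₀ Finset.subset_union_left h₀
  rw [← finsum_mem_inter_add_sdiff (emptyTriangles Y ∩ B) (finite_emptyTriangles_inter hfin α),
    ← finsum_mem_inter_add_sdiff (emptyTriangles X ∩ B)
      (finite_emptyTriangles_inter hfinY α), e₁, e₀, Set.inter_comm (emptyTriangles X ∩ B)]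
  ring

/-- Up to sign, the determinant whose vanishing expresses that four points of the plane are
cocircular or collinear. -/
def circleDet (a b c d : EuclideanSpace ℝ (Fin 2)) : ℝ :=
  ((a 0 - d 0) ^ 2 + (a 1 - d 1) ^ 2) *
      ((b 0 - d 0) * (c 1 - d 1) - (b 1 - d 1) * (c 0 - d 0)) -
    ((b 0 - d 0) ^ 2 + (b 1 - d 1) ^ 2) *
      ((a 0 - d 0) * (c 1 - d 1) - (a 1 - d 1) * (c 0 - d 0)) +
    ((c 0 - d 0) ^ 2 + (c 1 - d 1) ^ 2) *
      ((a 0 - d 0) * (b 1 - d 1) - (a 1 - d 1) * (b 0 - d 0))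

theorem dist_sq_eq_coords (x y : EuclideanSpace ℝ (Fin 2)) :
    dist x y ^ 2 = (x 0 - y 0) ^ 2 + (x 1 - y 1) ^ 2 := by
  rw [EuclideanSpace.dist_eq, Real.sq_sqrt (by positivity), Fin.sum_univ_two,
    Real.dist_eq, Real.dist_eq, sq_abs, sq_abs]

theorem ext_coords {x y : EuclideanSpace ℝ (Fin 2)} (h₀ : x 0 = y 0) (h₁ : x 1 = y 1) :
    x = y := by
  ext i
  fin_cases i
  · exact h₀
  · exact h₁

theorem circleDet_eq_zero {a b c d m : EuclideanSpace ℝ (Fin 2)} {ρ : ℝ}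
    (ha : dist a m = ρ) (hb : dist b m = ρ) (hc : dist c m = ρ) (hd : dist d m = ρ) :
    circleDet a b c d = 0 := by
  have h (x) (hx : dist x m = ρ) : (x 0 - d 0) ^ 2 + (x 1 - d 1) ^ 2 =
      2 * ((x 0 - d 0) * (m 0 - d 0) + (x 1 - d 1) * (m 1 - d 1)) := by
    have h₁ := dist_sq_eq_coords x m
    have h₂ := dist_sq_eq_coords d m
    rw [hx] at h₁
    rw [hd] at h₂
    linear_combination h₂ - h₁
  rw [circleDet, h a ha, h b hb, h c hc]
  ring

theorem Continuous.circleDet {α : Type*} [TopologicalSpace α]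
    {a b c d : α → EuclideanSpace ℝ (Fin 2)} (ha : Continuous a) (hb : Continuous b)
    (hc : Continuous c) (hd : Continuous d) :
    Continuous fun x => circleDet (a x) (b x) (c x) (d x) := by
  unfold _root_.circleDet
  fun_prop

theorem exists_small_quadratic_ne_zero {A B C : ℝ} (h : A ≠ 0 ∨ B ≠ 0) {ε : ℝ} (hε : 0 < ε) :
    ∃ τ, |τ| < ε ∧ A * τ ^ 2 + B * τ + C ≠ 0 := by
  by_contra! hc
  have h₀ := hc 0 (by simpa using hε)
  have h₁ := hc (ε / 2) (by rw [abs_of_pos (by positivity)]; linarith)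
  have h₂ := hc (-(ε / 2)) (by rw [abs_neg, abs_of_pos (by positivity)]; linarith)
  have hB : B * ε = 0 := by linear_combination h₁ - h₂
  have hA : A * ε ^ 2 = 0 := by linear_combination 2 * h₁ + 2 * h₂ - 4 * h₀
  rcases h with h | h
  · exact mul_ne_zero h (by positivity) hA
  · exact mul_ne_zero h hε.ne' hB

theorem exists_small_smul_ne_zero {e : EuclideanSpace ℝ (Fin 2)}
    {f : EuclideanSpace ℝ (Fin 2) → ℝ} {A B C : ℝ} (h : A ≠ 0 ∨ B ≠ 0)
    (hf : ∀ τ : ℝ, f (τ • e) = A * τ ^ 2 + B * τ + C) {ε : ℝ} (hε : 0 < ε) :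
    ∃ v, ‖v‖ < ε ∧ f v ≠ 0 := by
  obtain ⟨τ, hτ, hne⟩ := exists_small_quadratic_ne_zero (C := C) h
    (ε := ε / (‖e‖ + 1)) (by positivity)
  refine ⟨τ • e, ?_, by rwa [hf]⟩
  rw [lt_div_iff₀ (by positivity)] at hτ
  rw [norm_smul, Real.norm_eq_abs]
  nlinarith [abs_nonneg τ]

theorem exists_small_circleDet_add_ne_zero {b c d : EuclideanSpace ℝ (Fin 2)}
    (hbc : b ≠ c) (hbd : b ≠ d) (hcd : c ≠ d) (a : EuclideanSpace ℝ (Fin 2))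
    {ε : ℝ} (hε : 0 < ε) : ∃ v, ‖v‖ < ε ∧ circleDet (a + v) b c d ≠ 0 := by
  have hbc' := (pow_pos (dist_pos.2 hbc) 2)
  have hbd' := (pow_pos (dist_pos.2 hbd) 2)
  have hcd' := (pow_pos (dist_pos.2 hcd) 2)
  rw [dist_sq_eq_coords] at hbc' hbd' hcd'
  by_cases hk : (b 0 - d 0) * (c 1 - d 1) - (b 1 - d 1) * (c 0 - d 0) = 0
  · refine exists_small_smul_ne_zero (f := fun v => circleDet (a + v) b c d) (A := 0)
      (C := circleDet a b c d)
      (e := !₂[-(((c 0 - d 0) ^ 2 + (c 1 - d 1) ^ 2) * (b 1 - d 1) -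
          ((b 0 - d 0) ^ 2 + (b 1 - d 1) ^ 2) * (c 1 - d 1)),
        ((c 0 - d 0) ^ 2 + (c 1 - d 1) ^ 2) * (b 0 - d 0) -
          ((b 0 - d 0) ^ 2 + (b 1 - d 1) ^ 2) * (c 0 - d 0)])
      (Or.inr (b := -(((b 0 - d 0) ^ 2 + (b 1 - d 1) ^ 2) *
        ((c 0 - d 0) ^ 2 + (c 1 - d 1) ^ 2) * ((b 0 - c 0) ^ 2 + (b 1 - c 1) ^ 2)) ≠ 0) ?_) ?_ hε
    · exact (neg_neg_of_pos (by positivity)).ne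
    · intro τ
      simp only [circleDet, PiLp.add_apply, PiLp.smul_apply, smul_eq_mul, Matrix.cons_val_zero,
        Matrix.cons_val_one, hk]
      ring
  · refine exists_small_smul_ne_zero (f := fun v => circleDet (a + v) b c d)
      (A := (b 0 - d 0) * (c 1 - d 1) - (b 1 - d 1) * (c 0 - d 0))
      (B := circleDet (a + !₂[1, 0]) b c d - circleDet a b c d -
        ((b 0 - d 0) * (c 1 - d 1) - (b 1 - d 1) * (c 0 - d 0)))
      (C := circleDet a b c d) (e := !₂[1, 0]) (Or.inl hk) ?_ hε
    intro τ
    simp only [circleDet, PiLp.add_apply, PiLp.smul_apply, smul_eq_mul, Matrix.cons_val_zero,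
      Matrix.cons_val_one]
    ring

theorem exists_small_circleDet_add_add_ne_zero {a b c d : EuclideanSpace ℝ (Fin 2)}
    (hab : a ≠ b) (hcd : c ≠ d) {ε : ℝ} (hε : 0 < ε) :
    ∃ v, ‖v‖ < ε ∧ circleDet (a + v) (b + v) c d ≠ 0 := by
  have hab' := (pow_pos (dist_pos.2 hab) 2)
  have hcd' := (pow_pos (dist_pos.2 hcd) 2)
  rw [dist_sq_eq_coords] at hab' hcd'
  have key (e : EuclideanSpace ℝ (Fin 2))
      (he : (e 0 ^ 2 + e 1 ^ 2) * ((b 0 - a 0) * (c 1 - d 1) - (b 1 - a 1) * (c 0 - d 0)) -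
        2 * (e 0 * (b 0 - a 0) + e 1 * (b 1 - a 1)) *
          (e 0 * (c 1 - d 1) - e 1 * (c 0 - d 0)) ≠ 0) :
      ∃ v, ‖v‖ < ε ∧ circleDet (a + v) (b + v) c d ≠ 0 := by
    refine exists_small_smul_ne_zero (e := e) (f := fun v => circleDet (a + v) (b + v) c d)
      (B := circleDet (a + e) (b + e) c d - circleDet a b c d -
        ((e 0 ^ 2 + e 1 ^ 2) * ((b 0 - a 0) * (c 1 - d 1) - (b 1 - a 1) * (c 0 - d 0)) -
        2 * (e 0 * (b 0 - a 0) + e 1 * (b 1 - a 1)) *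
          (e 0 * (c 1 - d 1) - e 1 * (c 0 - d 0)))) (C := circleDet a b c d) (Or.inl he) ?_ hε
    intro τ
    simp only [circleDet, PiLp.add_apply, PiLp.smul_apply, smul_eq_mul]
    ring
  by_cases hk : (b 0 - a 0) * (c 1 - d 1) - (b 1 - a 1) * (c 0 - d 0) = 0
  · refine key !₂[b 0 - a 0 - (b 1 - a 1), b 1 - a 1 + (b 0 - a 0)] ?_
    simp only [Matrix.cons_val_zero, Matrix.cons_val_one, hk]
    intro h
    have h₁ : ((a 0 - b 0) ^ 2 + (a 1 - b 1) ^ 2) *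
        ((b 0 - a 0) * (c 0 - d 0) + (b 1 - a 1) * (c 1 - d 1)) = 0 := by
      linear_combination h / 2 + ((a 0 - b 0) ^ 2 + (a 1 - b 1) ^ 2) * hk
    have h₂ := (mul_eq_zero.1 h₁).resolve_left hab'.ne'
    refine (mul_pos hab' hcd').ne' ?_
    linear_combination ((b 0 - a 0) * (c 0 - d 0) + (b 1 - a 1) * (c 1 - d 1)) * h₂ +
      ((b 0 - a 0) * (c 1 - d 1) - (b 1 - a 1) * (c 0 - d 0)) * hk
  · refine key (b - a) ?_
    simp only [PiLp.sub_apply]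
    intro h
    refine mul_ne_zero hab'.ne' hk ?_
    linear_combination -h

theorem eq_of_forall_perm {ι : Type*} (p : Fin 4 → ι)
    (h : ∀ σ : Equiv.Perm (Fin 4),
      ¬ ((p (σ 1) ≠ p (σ 0) ∧ p (σ 2) ≠ p (σ 0) ∧ p (σ 3) ≠ p (σ 0)) ∨
        (p (σ 1) = p (σ 0) ∧ p (σ 2) ≠ p (σ 0) ∧ p (σ 3) ≠ p (σ 0)))) (i : Fin 4) :
    p i = p 0 := by
  have e1 := h 1
  have e2 := h (Equiv.swap 1 2)
  have e3 := h (Equiv.swap 1 3)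
  have e4 := h (Equiv.swap 0 1)
  have e5 := h (Equiv.swap 0 2)
  have e6 := h (Equiv.swap 0 3)
  have s1 : (Equiv.swap (1 : Fin 4) 2) 0 = 0 ∧ (Equiv.swap (1 : Fin 4) 2) 1 = 2 ∧
    (Equiv.swap (1 : Fin 4) 2) 2 = 1 ∧ (Equiv.swap (1 : Fin 4) 2) 3 = 3 := by decide
  have s2 : (Equiv.swap (1 : Fin 4) 3) 0 = 0 ∧ (Equiv.swap (1 : Fin 4) 3) 1 = 3 ∧
    (Equiv.swap (1 : Fin 4) 3) 2 = 2 ∧ (Equiv.swap (1 : Fin 4) 3) 3 = 1 := by decide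
  have s3 : (Equiv.swap (0 : Fin 4) 1) 0 = 1 ∧ (Equiv.swap (0 : Fin 4) 1) 1 = 0 ∧
    (Equiv.swap (0 : Fin 4) 1) 2 = 2 ∧ (Equiv.swap (0 : Fin 4) 1) 3 = 3 := by decide
  have s4 : (Equiv.swap (0 : Fin 4) 2) 0 = 2 ∧ (Equiv.swap (0 : Fin 4) 2) 1 = 1 ∧
    (Equiv.swap (0 : Fin 4) 2) 2 = 0 ∧ (Equiv.swap (0 : Fin 4) 2) 3 = 3 := by decide
  have s5 : (Equiv.swap (0 : Fin 4) 3) 0 = 3 ∧ (Equiv.swap (0 : Fin 4) 3) 1 = 1 ∧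
    (Equiv.swap (0 : Fin 4) 3) 2 = 2 ∧ (Equiv.swap (0 : Fin 4) 3) 3 = 0 := by decide
  simp only [Equiv.Perm.one_apply, s1, s2, s3, s4, s5] at e1 e2 e3 e4 e5 e6
  fin_cases i
  · rfl
  · grind
  · grind
  · grind

theorem exists_generic_translates {ι : Type*} [Countable ι]
    {K : Finset (EuclideanSpace ℝ (Fin 2))}
    (hK : Generic 2 (K : Set (EuclideanSpace ℝ (Fin 2)))) (c : ι → EuclideanSpace ℝ (Fin 2))
    (hsep : ∀ t : ι → EuclideanSpace ℝ (Fin 2), (∀ g, ‖t g‖ ≤ 1) → ∀ g g', ∀ w ∈ K, ∀ w' ∈ K,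
      c g + t g + w = c g' + t g' + w' → g = g') :
    ∃ t : ι → EuclideanSpace ℝ (Fin 2), (∀ g, ‖t g‖ ≤ 1) ∧
      Generic 2 {x | ∃ g, ∃ w ∈ K, c g + t g + w = x} := by
  classical
  let _ : TopologicalSpace ι := ⊥
  have : DiscreteTopology ι := ⟨rfl⟩
  let pt (t : BoundedContinuousFunction ι (EuclideanSpace ℝ (Fin 2))) (x : ι × K) :
    EuclideanSpace ℝ (Fin 2) := c x.1 + t x.1 + x.2
  have hpt (x) : Continuous fun t => pt t x := by
    have h : Continuous fun t : BoundedContinuousFunction ι (EuclideanSpace ℝ (Fin 2)) => t x.1 :=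
      continuous_eval_const x.1
    exact (continuous_const.add h).add continuous_const
  have hinj (t) (ht : ‖t‖ ≤ 1) (x y) (h : pt t x = pt t y) : x = y := by
    have h₁ : x.1 = y.1 := hsep t (fun g => (t.norm_coe_le_norm g).trans ht) _ _ _ x.2.2 _ y.2.2 h
    refine Prod.ext h₁ (Subtype.ext ?_)
    simpa [pt, h₁] using h
  let bump (i : ι) (v : EuclideanSpace ℝ (Fin 2)) :
      BoundedContinuousFunction ι (EuclideanSpace ℝ (Fin 2)) :=
    BoundedContinuousFunction.ofNormedAddCommGroupDiscrete (fun j => if j = i then v else 0) ‖v‖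
      (fun j => by split_ifs <;> simp)
  have hbump (i v) : ‖bump i v‖ ≤ ‖v‖ :=
    (BoundedContinuousFunction.norm_le (norm_nonneg _)).2
      (fun j => by change ‖if j = i then v else 0‖ ≤ _; split_ifs <;> simp)
  have hself (t i v) (x : ι × K) (hx : x.1 = i) : pt (t + bump i v) x = pt t x + v := by
    have : bump i v x.1 = v := if_pos hx
    simp only [pt, BoundedContinuousFunction.add_apply, this]
    abel
  have hother (t i v) (x : ι × K) (hx : x.1 ≠ i) : pt (t + bump i v) x = pt t x := by
    have : bump i v x.1 = 0 := if_neg hx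
    simp only [pt, BoundedContinuousFunction.add_apply, this, add_zero]
  let I := {x : Fin 4 → ι × K // Function.Injective x ∧
    (((x 1).1 ≠ (x 0).1 ∧ (x 2).1 ≠ (x 0).1 ∧ (x 3).1 ≠ (x 0).1) ∨
      ((x 1).1 = (x 0).1 ∧ (x 2).1 ≠ (x 0).1 ∧ (x 3).1 ≠ (x 0).1))}
  let U (x : I) : Set (BoundedContinuousFunction ι (EuclideanSpace ℝ (Fin 2))) :=
    {t | circleDet (pt t (x.1 0)) (pt t (x.1 1)) (pt t (x.1 2)) (pt t (x.1 3)) ≠ 0} ∪ {t | 1 < ‖t‖}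
  have hopen (x : I) : IsOpen (U x) := by
    refine IsOpen.union ?_ (isOpen_lt continuous_const continuous_norm)
    exact isOpen_ne_fun ((hpt _).circleDet (hpt _) (hpt _) (hpt _)) continuous_const
  have hdense (x : I) : Dense (U x) := by
    rw [Metric.dense_iff]
    intro t ε hε
    by_cases ht : 1 < ‖t‖
    · exact ⟨t, mem_ball_self hε, Or.inr ht⟩
    have hne (i j) (hij : i ≠ j) : pt t (x.1 i) ≠ pt t (x.1 j) := fun h =>
      hij (x.2.1 (hinj t (not_lt.1 ht) _ _ h))
    rcases x.2.2 with ⟨h₁, h₂, h₃⟩ | ⟨h₁, h₂, h₃⟩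
    · obtain ⟨v, hv, hdet⟩ := exists_small_circleDet_add_ne_zero
        (hne 1 2 (by decide)) (hne 1 3 (by decide)) (hne 2 3 (by decide)) (pt t (x.1 0)) hε
      refine ⟨t + bump (x.1 0).1 v, by simpa using (hbump _ _).trans_lt hv, Or.inl ?_⟩
      simp only [Set.mem_ofPred_eq]
      rwa [hself t _ v _ rfl, hother t _ v _ h₁, hother t _ v _ h₂, hother t _ v _ h₃]
    · obtain ⟨v, hv, hdet⟩ := exists_small_circleDet_add_add_ne_zero
        (hne 0 1 (by decide)) (hne 2 3 (by decide)) hε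
      refine ⟨t + bump (x.1 0).1 v, by simpa using (hbump _ _).trans_lt hv, Or.inl ?_⟩
      simp only [Set.mem_ofPred_eq]
      rwa [hself t _ v _ rfl, hself t _ v _ h₁, hother t _ v _ h₂, hother t _ v _ h₃]
  have hI : Countable I := Subtype.countable
  obtain ⟨t, ht, htU⟩ := (dense_iInter_of_isOpen hopen hdense).inter_open_nonempty (ball 0 1)
    isOpen_ball ⟨0, mem_ball_self one_pos⟩
  rw [mem_ball_zero_iff] at ht
  have hU (x : I) : circleDet (pt t (x.1 0)) (pt t (x.1 1)) (pt t (x.1 2)) (pt t (x.1 3)) ≠ 0 :=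
    (Set.mem_iInter.1 htU x).resolve_right ht.le.not_gt
  refine ⟨t, fun g => (t.norm_coe_le_norm g).trans ht.le, ?_⟩
  rintro Y hY ⟨m, ρ, hm⟩
  by_contra! hcard
  obtain ⟨Y', hY', hcard'⟩ := Finset.exists_subset_card_eq (show 4 ≤ Y.card by omega)
  let f := (Finset.equivFinOfCardEq hcard').symm
  have hx (i : Fin 4) : ∃ x : ι × K, pt t x = f i := by
    obtain ⟨g, w, hw, h⟩ := hY (hY' (f i).2)
    exact ⟨(g, ⟨w, hw⟩), h⟩
  choose x hx using hx
  have hxinj : Function.Injective x := fun i j h => by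
    have := (hx i).symm.trans ((congrArg (pt t) h).trans (hx j))
    exact f.injective (Subtype.ext this)
  have hdist (i) : dist (pt t (x i)) m = ρ := by
    rw [hx]
    exact hm _ (hY' (f i).2)
  have hperm (σ : Equiv.Perm (Fin 4)) :
      ¬ (((x (σ 1)).1 ≠ (x (σ 0)).1 ∧ (x (σ 2)).1 ≠ (x (σ 0)).1 ∧ (x (σ 3)).1 ≠ (x (σ 0)).1) ∨
      ((x (σ 1)).1 = (x (σ 0)).1 ∧ (x (σ 2)).1 ≠ (x (σ 0)).1 ∧ (x (σ 3)).1 ≠ (x (σ 0)).1)) :=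
    fun h => hU ⟨x ∘ σ, hxinj.comp σ.injective, h⟩
      (circleDet_eq_zero (hdist _) (hdist _) (hdist _) (hdist _))
  have hsame := eq_of_forall_perm (fun i => (x i).1) hperm
  have hcard4 := hK (Finset.univ.image fun i => ((x i).2 : EuclideanSpace ℝ (Fin 2)))
    (by
      intro y hy
      obtain ⟨i, -, rfl⟩ := Finset.mem_image.1 hy
      exact (x i).2.2)
    ⟨m - (c (x 0).1 + t (x 0).1), ρ, by
      intro y hy
      obtain ⟨i, -, rfl⟩ := Finset.mem_image.1 hy
      rw [← hdist i, dist_eq_norm, dist_eq_norm]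
      simp only [pt, hsame]
      congr 1
      abel⟩
  rw [Finset.card_image_of_injective, Finset.card_univ, Fintype.card_fin] at hcard4
  · omega
  · intro i j h
    exact hxinj (Prod.ext ((hsame i).trans (hsame j).symm) (Subtype.ext h))

theorem volume_closedBall_toReal {α : ℝ} (hα : 0 ≤ α) :
    (volume (closedBall (0 : EuclideanSpace ℝ (Fin 2)) α)).toReal =
      α ^ 2 * (volume (ball (0 : EuclideanSpace ℝ (Fin 2)) 1)).toReal := by
  rw [Measure.addHaar_closedBall _ _ hα, ENNReal.toReal_mul, ENNReal.toReal_ofReal (by positivity),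
    finrank_euclideanSpace_fin]

theorem volume_unitBall_toReal_pos :
    0 < (volume (ball (0 : EuclideanSpace ℝ (Fin 2)) 1)).toReal :=
  ENNReal.toReal_pos (measure_ball_pos _ _ one_pos).ne' measure_ball_lt_top.ne

theorem eq_zero_of_tendsto_density {f f' : ℝ → ℝ} {l l' : ℝ}
    (hf : Tendsto (fun α => f α / (volume (closedBall (0 : EuclideanSpace ℝ (Fin 2)) α)).toReal)
      atTop (nhds l))
    (hf' : Tendsto (fun α => f' α / (volume (closedBall (0 : EuclideanSpace ℝ (Fin 2)) α)).toReal)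
      atTop (nhds l'))
    {k δ : ℝ} (hk : 0 < k) {a : ℕ → ℝ} (ha : ∀ n, 100 ^ n ≤ a n)
    (h₁ : ∀ n, f (k * 10 ^ n) - f' (k * 10 ^ n) = a n * δ)
    (h₂ : ∀ n, f (2 * (k * 10 ^ n)) - f' (2 * (k * 10 ^ n)) = a n * δ) : δ = 0 := by
  set β := (volume (ball (0 : EuclideanSpace ℝ (Fin 2)) 1)).toReal with hβ
  have hβ0 : 0 < β := volume_unitBall_toReal_pos
  have hα : Tendsto (fun n : ℕ => k * (10 : ℝ) ^ n) atTop atTop :=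
    (tendsto_pow_atTop_atTop_of_one_lt (by norm_num)).const_mul_atTop hk
  have hα' := hα.const_mul_atTop (two_pos (α := ℝ))
  have t₁ : Tendsto (fun n => a n * δ / ((k * 10 ^ n) ^ 2 * β)) atTop (nhds (l - l')) := by
    refine ((hf.comp hα).sub (hf'.comp hα)).congr fun n => ?_
    simp only [Function.comp_apply]
    rw [← sub_div, h₁, volume_closedBall_toReal (by positivity)]
  have t₂ : Tendsto (fun n => a n * δ / ((k * 10 ^ n) ^ 2 * β) / 4) atTop (nhds (l - l')) := by
    refine ((hf.comp hα').sub (hf'.comp hα')).congr fun n => ?_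
    simp only [Function.comp_apply]
    rw [← sub_div, h₂, volume_closedBall_toReal (by positivity), div_div]
    congr 1
    ring
  have hL : l - l' = 0 := by
    have := tendsto_nhds_unique t₂ (t₁.div_const 4)
    linarith
  rw [hL] at t₁
  have hlow (n : ℕ) : |δ| / (k ^ 2 * β) ≤ |a n * δ / ((k * 10 ^ n) ^ 2 * β)| := by
    have hpos : 0 < a n := lt_of_lt_of_le (by positivity) (ha n)
    rw [abs_div, abs_mul, abs_of_pos hpos, abs_of_pos (show 0 < (k * 10 ^ n) ^ 2 * β by positivity),
      div_le_div_iff₀ (by positivity) (by positivity)]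
    have : (k * 10 ^ n) ^ 2 * β = k ^ 2 * β * 100 ^ n := by
      rw [mul_pow, ← pow_mul, mul_comm n 2, pow_mul]
      norm_num
      ring
    rw [this]
    have := mul_le_mul_of_nonneg_left (ha n) (show 0 ≤ |δ| * (k ^ 2 * β) by positivity)
    linarith
  have h := ge_of_tendsto' t₁.abs hlow
  rw [abs_zero] at h
  by_contra hδ
  have : 0 < |δ| / (k ^ 2 * β) := by positivity
  linarith

/-- The points of the integer lattice. -/
def latticePoint (g : ℤ × ℤ) : EuclideanSpace ℝ (Fin 2) := !₂[(g.1 : ℝ), (g.2 : ℝ)]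

theorem latticePoint_zero (g : ℤ × ℤ) : latticePoint g 0 = g.1 := rfl

theorem latticePoint_one (g : ℤ × ℤ) : latticePoint g 1 = g.2 := rfl

theorem norm_le_abs_add_abs (x : EuclideanSpace ℝ (Fin 2)) : ‖x‖ ≤ |x 0| + |x 1| := by
  have h := dist_sq_eq_coords x 0
  rw [dist_zero_right] at h
  simp only [PiLp.zero_apply, sub_zero] at h
  refine abs_le_of_sq_le_sq' ?_ (by positivity) |>.2
  rw [h, ← sq_abs (x 0), ← sq_abs (x 1)]
  nlinarith [abs_nonneg (x 0), abs_nonneg (x 1)]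

theorem abs_apply_le_norm (x : EuclideanSpace ℝ (Fin 2)) (i : Fin 2) : |x i| ≤ ‖x‖ :=
  PiLp.norm_apply_le x i

theorem one_le_norm_latticePoint_sub {g g' : ℤ × ℤ} (h : g ≠ g') :
    1 ≤ ‖latticePoint g - latticePoint g'‖ := by
  by_cases h₁ : g.1 = g'.1
  · have h₂ : g.2 - g'.2 ≠ 0 := fun h₂ => h (Prod.ext h₁ (sub_eq_zero.1 h₂))
    refine le_trans ?_ (abs_apply_le_norm _ 1)
    rw [PiLp.sub_apply, latticePoint_one, latticePoint_one]
    exact_mod_cast Int.one_le_abs h₂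
  · refine le_trans ?_ (abs_apply_le_norm _ 0)
    rw [PiLp.sub_apply, latticePoint_zero, latticePoint_zero]
    exact_mod_cast Int.one_le_abs (sub_ne_zero.2 h₁)

theorem exists_norm_latticePoint_sub_le (z : EuclideanSpace ℝ (Fin 2)) :
    ∃ g, ‖latticePoint g - z‖ ≤ 2 := by
  refine ⟨(round (z 0), round (z 1)), (norm_le_abs_add_abs _).trans ?_⟩
  have h₀ := abs_sub_round (z 0)
  have h₁ := abs_sub_round (z 1)
  rw [abs_sub_comm] at h₀ h₁
  rw [PiLp.sub_apply, PiLp.sub_apply, latticePoint_zero, latticePoint_one]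
  linarith

/-- A square block of lattice points at distance of order `10 ^ j` from the origin. -/
def block (j : ℕ) : Finset (ℤ × ℤ) := Finset.Ico (10 ^ j) (2 * 10 ^ j) ×ˢ Finset.Ico 0 (10 ^ j)

theorem card_block (j : ℕ) : (block j).card = 100 ^ j := by
  rw [block, Finset.card_product, Int.card_Ico, Int.card_Ico]
  have h₁ : (2 * 10 ^ j - 10 ^ j : ℤ) = ((10 ^ j : ℕ) : ℤ) := by push_cast; ring
  have h₂ : (10 ^ j - 0 : ℤ) = ((10 ^ j : ℕ) : ℤ) := by push_cast; ring
  rw [h₁, h₂, Int.toNat_natCast, ← mul_pow]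
  norm_num

theorem norm_latticePoint_of_mem_block {g : ℤ × ℤ} {j : ℕ} (hg : g ∈ block j) :
    10 ^ j ≤ ‖latticePoint g‖ ∧ ‖latticePoint g‖ ≤ 3 * 10 ^ j := by
  simp only [block, Finset.mem_product, Finset.mem_Ico] at hg
  obtain ⟨⟨h₁, h₂⟩, h₃, h₄⟩ := hg
  have h₁' : (10 : ℝ) ^ j ≤ g.1 := by exact_mod_cast h₁
  have h₂' : (g.1 : ℝ) < 2 * 10 ^ j := by exact_mod_cast h₂
  have h₃' : (0 : ℝ) ≤ g.2 := by exact_mod_cast h₃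
  have h₄' : (g.2 : ℝ) < 10 ^ j := by exact_mod_cast h₄
  have hpos : (0 : ℝ) < 10 ^ j := by positivity
  constructor
  · refine h₁'.trans ((le_abs_self _).trans (abs_apply_le_norm (latticePoint g) 0))
  · refine (norm_le_abs_add_abs _).trans ?_
    rw [latticePoint_zero, latticePoint_one, abs_of_nonneg h₃', abs_of_pos (by linarith)]
    linarith

theorem norm_le_iff_of_mem_block {g : ℤ × ℤ} {j n : ℕ} (hg : g ∈ block j) {h : ℝ} (hh : 0 < h)
    {x : EuclideanSpace ℝ (Fin 2)} (hx : ‖x - h • latticePoint g‖ ≤ h / 2) {α : ℝ}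
    (hα : 4 * h * 10 ^ n ≤ α) (hα' : α ≤ 8 * h * 10 ^ n) : ‖x‖ ≤ α ↔ j ≤ n := by
  obtain ⟨h₁, h₂⟩ := norm_latticePoint_of_mem_block hg
  have e : ‖h • latticePoint g‖ = h * ‖latticePoint g‖ := by
    rw [norm_smul, Real.norm_of_nonneg hh.le]
  have u : ‖x‖ ≤ h / 2 + h * ‖latticePoint g‖ := by
    rw [← e]
    calc ‖x‖ = ‖(x - h • latticePoint g) + h • latticePoint g‖ := by rw [sub_add_cancel]
      _ ≤ _ := (norm_add_le _ _).trans (by gcongr)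
  have l : h * ‖latticePoint g‖ ≤ ‖x‖ + h / 2 := by
    rw [← e]
    calc ‖h • latticePoint g‖ = ‖x - (x - h • latticePoint g)‖ := by rw [sub_sub_cancel]
      _ ≤ _ := (norm_sub_le _ _).trans (by gcongr)
  have hn : (1 : ℝ) ≤ 10 ^ n := one_le_pow₀ (by norm_num)
  have hj : (1 : ℝ) ≤ 10 ^ j := one_le_pow₀ (by norm_num)
  constructor
  · intro hxα
    by_contra! hlt
    have hp : (10 : ℝ) ^ (n + 1) ≤ 10 ^ j := pow_le_pow_right₀ (by norm_num) hlt
    rw [pow_succ] at hp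
    have : h * (10 ^ n * 10) ≤ h * ‖latticePoint g‖ := by gcongr; linarith
    nlinarith
  · intro hle
    have hp : (10 : ℝ) ^ j ≤ 10 ^ n := pow_le_pow_right₀ (by norm_num) hle
    have : h * ‖latticePoint g‖ ≤ h * (3 * 10 ^ n) := by gcongr; linarith
    nlinarith

section FarTranslates

variable {ι : Type*} {pos : ι → EuclideanSpace ℝ (Fin 2)}
  {K : Finset (EuclideanSpace ℝ (Fin 2))} {N : ℝ}

theorem eq_of_add_eq_add (hN₀ : 0 < N) (hN : ∀ w ∈ K, ‖w‖ ≤ N)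
    (hfar : ∀ g g', g ≠ g' → 3 * N ≤ ‖pos g - pos g'‖) {g g' : ι}
    {w w' : EuclideanSpace ℝ (Fin 2)} (hw : w ∈ K) (hw' : w' ∈ K)
    (h : pos g + w = pos g' + w') : g = g' := by
  by_contra hne
  have h₁ : pos g - pos g' = w' - w := by
    rw [sub_eq_sub_iff_add_eq_add, h, add_comm]
  have h₂ := hfar g g' hne
  rw [h₁] at h₂
  linarith [norm_sub_le w' w, hN w hw, hN w' hw']

theorem emptySimplex_translateFinset (hN : ∀ w ∈ K, ‖w‖ ≤ N)
    (hfar : ∀ g g', g ≠ g' → 3 * N ≤ ‖pos g - pos g'‖)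
    {X : Set (EuclideanSpace ℝ (Fin 2))} (hX : ∀ x ∈ X, ∃ g, ∃ w ∈ K, pos g + w = x) {g : ι}
    {s : Finset (EuclideanSpace ℝ (Fin 2))} {c : EuclideanSpace ℝ (Fin 2)} {ρ : ℝ}
    (hs : ∀ v ∈ s, dist v c = ρ) (hc : ‖c‖ + ρ ≤ N)
    (hemp : ∀ w ∈ K, pos g + w ∈ X → ρ ≤ dist w c) :
    EmptySimplex 2 (translateFinset (pos g) s) X := by
  refine ⟨pos g + c, ρ, fun v hv => ?_, fun x hx => ?_⟩
  · obtain ⟨y, hy, rfl⟩ := mem_translateFinset.1 hv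
    rw [dist_add_left, hs y hy]
  · obtain ⟨g', w, hw, rfl⟩ := hX x hx
    by_cases hg : g' = g
    · subst hg
      rw [dist_add_left]
      exact hemp w hw hx
    · have h₁ := hfar g' g hg
      have h₂ : pos g' - pos g = (pos g' + w - (pos g + c)) - (w - c) := by abel
      have h₃ := norm_sub_le (pos g' + w - (pos g + c)) (w - c)
      rw [← h₂] at h₃
      rw [dist_eq_norm]
      linarith [norm_sub_le w c, hN w hw, norm_nonneg w]

theorem emptySimplex_of_translateFinset {v : EuclideanSpace ℝ (Fin 2)}
    {s : Finset (EuclideanSpace ℝ (Fin 2))} {X W : Set (EuclideanSpace ℝ (Fin 2))}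
    (hW : ∀ w ∈ W, v + w ∈ X) (h : EmptySimplex 2 (translateFinset v s) X) :
    EmptySimplex 2 s W := by
  obtain ⟨c, ρ, hs, hc⟩ := h
  have e (w : EuclideanSpace ℝ (Fin 2)) : dist w (c - v) = dist (v + w) c := by
    rw [dist_eq_norm, dist_eq_norm]
    congr 1
    abel
  refine ⟨c - v, ρ, fun w hw => ?_, fun w hw => ?_⟩
  · rw [e]
    exact hs _ (mem_translateFinset.2 ⟨w, hw, rfl⟩)
  · rw [e]
    exact hc _ (hW w hw)

theorem exists_separation_radius (hN₁ : 1 ≤ N) (hN : ∀ w ∈ K, ‖w‖ ≤ N)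
    (hfar : ∀ g g', g ≠ g' → 3 * N ≤ ‖pos g - pos g'‖) :
    ∃ r, 0 < r ∧ r ≤ 1 ∧ ∀ X : Set (EuclideanSpace ℝ (Fin 2)),
      (∀ x ∈ X, ∃ g, ∃ w ∈ K, pos g + w = x) → ∀ z, (X ∩ ball z r).Subsingleton := by
  have hev : ∀ᶠ δ in nhdsWithin (0 : ℝ) (Set.Ioi 0), ∀ w ∈ K, ∀ w' ∈ K, w ≠ w' →
      2 * δ < dist w w' := by
    refine (Filter.eventually_all_finset K).2 fun w _ => (Filter.eventually_all_finset K).2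
      fun w' _ => ?_
    by_cases hww : w = w'
    · exact Eventually.of_forall fun _ h => absurd hww h
    · have hlt : ∀ᶠ δ in nhds (0 : ℝ), 2 * δ < dist w w' := by
        have hcont : Continuous fun δ : ℝ => 2 * δ := by fun_prop
        refine hcont.continuousAt.eventually_lt continuousAt_const ?_
        simpa using hww
      exact (hlt.filter_mono nhdsWithin_le_nhds).mono fun _ h _ => h
  have hev' : ∀ᶠ δ in nhdsWithin (0 : ℝ) (Set.Ioi 0), δ < 1 / 2 :=
    nhdsWithin_le_nhds (eventually_lt_nhds (by norm_num))
  obtain ⟨r, ⟨hr, hr₁⟩, hr₀⟩ := ((hev.and hev').and self_mem_nhdsWithin).exists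
  refine ⟨r, hr₀, by linarith, fun X hX z => ?_⟩
  rintro x ⟨hx, hxz⟩ y ⟨hy, hyz⟩
  have hxy : dist x y < 2 * r := by
    have := dist_triangle_right x y z
    rw [mem_ball] at hxz hyz
    linarith
  obtain ⟨g, w, hw, rfl⟩ := hX x hx
  obtain ⟨g', w', hw', rfl⟩ := hX y hy
  by_cases hg : g = g'
  · subst hg
    rw [dist_add_left] at hxy
    by_contra hne
    have := hr w hw w' hw' fun h => hne (by rw [h])
    linarith
  · exfalso
    have h₁ := hfar g g' hg
    have h₂ : pos g - pos g' = (pos g + w - (pos g' + w')) - (w - w') := by abel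
    have h₃ := norm_sub_le (pos g + w - (pos g' + w')) (w - w')
    rw [← h₂] at h₃
    rw [dist_eq_norm] at hxy
    linarith [norm_sub_le w w', hN w hw, hN w' hw']

end FarTranslates

theorem exists_norm_bound (K : Finset (EuclideanSpace ℝ (Fin 2)))
    (T : Finset (Finset (EuclideanSpace ℝ (Fin 2)) × Set (EuclideanSpace ℝ (Fin 2))))
    (hT : ∀ s ∈ T, EmptySimplex 2 s.1 s.2) :
    ∃ N : ℝ, 1 ≤ N ∧ (∀ w ∈ K, ‖w‖ ≤ N) ∧ ∀ s ∈ T, ∃ c ρ, (∀ v ∈ s.1, dist v c = ρ) ∧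
      ‖c‖ + ρ ≤ N ∧ ∀ x ∈ s.2, ρ ≤ dist x c := by
  have h₁ : ∀ᶠ N : ℝ in atTop, ∀ w ∈ K, ‖w‖ ≤ N :=
    (Filter.eventually_all_finset K).2 fun w _ => eventually_ge_atTop _
  have h₂ : ∀ᶠ N : ℝ in atTop, ∀ s ∈ T, ∃ c ρ, (∀ v ∈ s.1, dist v c = ρ) ∧
      ‖c‖ + ρ ≤ N ∧ ∀ x ∈ s.2, ρ ≤ dist x c := by
    refine (Filter.eventually_all_finset T).2 fun s hs => ?_
    obtain ⟨c, ρ, h, h'⟩ := hT s hs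
    exact (eventually_ge_atTop (‖c‖ + ρ)).mono fun N hN => ⟨c, ρ, h, hN, h'⟩
  obtain ⟨N, ⟨hN, hN'⟩, hN''⟩ := ((eventually_ge_atTop 1).and h₁ |>.and h₂).exists
  exact ⟨N, hN, hN', hN''⟩

section Exchange

variable {F : Finset (EuclideanSpace ℝ (Fin 2)) → ℝ}
  (hinv : ∀ (φ : EuclideanSpace ℝ (Fin 2) ≃ᵢ EuclideanSpace ℝ (Fin 2))
    (s : Finset (EuclideanSpace ℝ (Fin 2))), F (s.map φ.toEquiv.toEmbedding) = F s)
  (hlim : ∀ (X : Set (EuclideanSpace ℝ (Fin 2))) (r R : ℝ), 0 < r → r < R →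
    DelaunaySet 2 X r R → Generic 2 X →
    ∀ D : Geometry.SimplicialComplex ℝ (EuclideanSpace ℝ (Fin 2)),
      IsDelaunayTriangulation 2 D X →
      ∃ l : ℝ, Tendsto (fun α : ℝ =>
        (∑ᶠ s ∈ {s : Finset (EuclideanSpace ℝ (Fin 2)) |
            s ∈ D.faces ∧ s.card = 3 ∧
              (s : Set (EuclideanSpace ℝ (Fin 2))) ⊆ closedBall 0 α}, F s) /
        (volume (closedBall (0 : EuclideanSpace ℝ (Fin 2)) α)).toReal) atTop (nhds l))

include hlim in
theorem exists_tendsto_emptyTriangles {X : Set (EuclideanSpace ℝ (Fin 2))} {r R : ℝ}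
    (hr : 0 < r) (hrR : r < R) (hX : DelaunaySet 2 X r R) (hgen : Generic 2 X) :
    ∃ l : ℝ, Tendsto (fun α : ℝ => (∑ᶠ s ∈ emptyTriangles X ∩ insideBall α, F s) /
      (volume (closedBall (0 : EuclideanSpace ℝ (Fin 2)) α)).toReal) atTop (nhds l) := by
  obtain ⟨l, hl⟩ := hlim X r R hr hrR hX hgen (delaunayComplex X hgen)
    (isDelaunayTriangulation_delaunayComplex hgen (finite_inter_closedBall hr hX.1) hX.2)
  refine ⟨l, hl.congr fun α => ?_⟩
  rw [finsum_delaunayComplex]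

include hinv hlim in
/-- If inserting the point `p` into the finite generic set `V` replaces the empty triangles `T₀` by
the empty triangles `T₁`, then `T₀` and `T₁` have the same total value. -/
theorem sum_eq_sum_of_exchange {V : Finset (EuclideanSpace ℝ (Fin 2))} (hV : V.Nonempty)
    {p : EuclideanSpace ℝ (Fin 2)} (hp : p ∉ V)
    (hgen : Generic 2 (insert p (V : Set (EuclideanSpace ℝ (Fin 2)))))
    {T₀ T₁ : Finset (Finset (EuclideanSpace ℝ (Fin 2)))}
    (h₀ : ∀ s ∈ T₀, s.card = 3 ∧ s ⊆ V ∧ EmptySimplex 2 s V ∧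
      ¬ EmptySimplex 2 s (insert p (V : Set (EuclideanSpace ℝ (Fin 2)))))
    (h₁ : ∀ s ∈ T₁, s.card = 3 ∧ (s : Set (EuclideanSpace ℝ (Fin 2))) ⊆ insert p ↑V ∧ p ∈ s ∧
      EmptySimplex 2 s (insert p (V : Set (EuclideanSpace ℝ (Fin 2)))))
    (hcov : ∀ s ∈ T₁, ∀ z ∈ convexHull ℝ (s : Set (EuclideanSpace ℝ (Fin 2))),
      ∃ s' ∈ T₀, z ∈ convexHull ℝ (s' : Set (EuclideanSpace ℝ (Fin 2))))
    (hnhds : ∀ᶠ z in nhds p, ∃ s ∈ T₁, z ∈ convexHull ℝ (s : Set (EuclideanSpace ℝ (Fin 2)))) :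
    ∑ s ∈ T₁, F s = ∑ s ∈ T₀, F s := by
  classical
  set K : Finset (EuclideanSpace ℝ (Fin 2)) := insert p V with hK
  have hKc : (K : Set (EuclideanSpace ℝ (Fin 2))) = insert p (V : Set _) := by
    rw [hK, Finset.coe_insert]
  have hVK : V ⊆ K := Finset.subset_insert p V
  have hpK : p ∈ K := Finset.mem_insert_self p V
  rw [← hKc] at hgen
  obtain ⟨N, hN₁, hN, hT⟩ := exists_norm_bound K
    (T₀.image (fun s => (s, (V : Set (EuclideanSpace ℝ (Fin 2))))) ∪
      T₁.image (fun s => (s, (K : Set (EuclideanSpace ℝ (Fin 2)))))) (by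
    intro s hs
    rcases Finset.mem_union.1 hs with hs | hs
    · obtain ⟨s, hs', rfl⟩ := Finset.mem_image.1 hs
      exact (h₀ s hs').2.2.1
    · obtain ⟨s, hs', rfl⟩ := Finset.mem_image.1 hs
      rw [hKc]
      exact (h₁ s hs').2.2.2)
  have hT₀ (s) (hs : s ∈ T₀) := hT _ (Finset.mem_union_left _ (Finset.mem_image_of_mem _ hs))
  have hT₁ (s) (hs : s ∈ T₁) := hT _ (Finset.mem_union_right _ (Finset.mem_image_of_mem _ hs))
  set h : ℝ := 5 * N + 5 with hh
  have hh₀ : 0 < h := by linarith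
  have hfar' (t : ℤ × ℤ → EuclideanSpace ℝ (Fin 2)) (ht : ∀ g, ‖t g‖ ≤ 1) (g g') (hg : g ≠ g') :
      3 * N ≤ ‖(h • latticePoint g + t g) - (h • latticePoint g' + t g')‖ := by
    have e₁ : h • (latticePoint g - latticePoint g') =
        ((h • latticePoint g + t g) - (h • latticePoint g' + t g')) - (t g - t g') := by
      rw [smul_sub]
      abel
    have e₂ := norm_sub_le ((h • latticePoint g + t g) - (h • latticePoint g' + t g')) (t g - t g')
    rw [← e₁, norm_smul, Real.norm_of_nonneg hh₀.le] at e₂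
    have e₃ := mul_le_mul_of_nonneg_left (one_le_norm_latticePoint_sub hg) hh₀.le
    linarith [norm_sub_le (t g) (t g'), ht g, ht g']
  obtain ⟨t, ht, hZ⟩ := exists_generic_translates hgen (fun g => h • latticePoint g)
    fun t ht g g' w hw w' hw' e =>
      eq_of_add_eq_add (pos := fun g => h • latticePoint g + t g) (by linarith) hN
        (hfar' t ht) hw hw' e
  let pos (g : ℤ × ℤ) : EuclideanSpace ℝ (Fin 2) := h • latticePoint g + t g
  have hfar : ∀ g g', g ≠ g' → 3 * N ≤ ‖pos g - pos g'‖ := hfar' t ht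
  have hinj {g g' : ℤ × ℤ} {w w'} (hw : w ∈ K) (hw' : w' ∈ K) (e : pos g + w = pos g' + w') :
    g = g' := eq_of_add_eq_add (by linarith) hN hfar hw hw' e
  let S : Set (ℤ × ℤ) := {g | ∃ j, g ∈ block j}
  let Y : Set (EuclideanSpace ℝ (Fin 2)) := {x | ∃ g, ∃ w ∈ V, pos g + w = x}
  let X : Set (EuclideanSpace ℝ (Fin 2)) := Y ∪ {x | ∃ g ∈ S, pos g + p = x}
  have hYX : Y ⊆ X := Set.subset_union_left
  have hXZ : ∀ x ∈ X, ∃ g, ∃ w ∈ K, pos g + w = x := by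
    rintro x (⟨g, w, hw, rfl⟩ | ⟨g, -, rfl⟩)
    · exact ⟨g, w, hVK hw, rfl⟩
    · exact ⟨g, p, hpK, rfl⟩
  have hXgen : Generic 2 X := hZ.mono hXZ
  have hYgen : Generic 2 Y := hXgen.mono hYX
  have hYp (g) : pos g + p ∉ Y := by
    rintro ⟨g', w, hw, e⟩
    obtain rfl := hinj (hVK hw) hpK e
    exact hp (add_left_cancel e ▸ hw)
  have hSX {g} (hg : g ∈ S) {w} (hw : w ∈ K) : pos g + w ∈ X := by
    rcases Finset.mem_insert.1 hw with rfl | hw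
    · exact Or.inr ⟨g, hg, rfl⟩
    · exact Or.inl ⟨g, w, hw, rfl⟩
  obtain ⟨r, hr₀, hr₁, hr⟩ := exists_separation_radius hN₁ hN hfar
  obtain ⟨v₀, hv₀⟩ := hV
  have hRY (z : EuclideanSpace ℝ (Fin 2)) : (Y ∩ closedBall z (2 * h + 1 + N)).Nonempty := by
    obtain ⟨g, hg⟩ := exists_norm_latticePoint_sub_le (h⁻¹ • z)
    refine ⟨pos g + v₀, ⟨g, v₀, hv₀, rfl⟩, ?_⟩
    have e : pos g + v₀ - z = h • (latticePoint g - h⁻¹ • z) + (t g + v₀) := by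
      rw [smul_sub, smul_inv_smul₀ hh₀.ne']
      simp only [pos]
      abel
    rw [mem_closedBall, dist_eq_norm, e]
    refine (norm_add_le _ _).trans ?_
    rw [norm_smul, Real.norm_of_nonneg hh₀.le]
    have := mul_le_mul_of_nonneg_left hg hh₀.le
    linarith [norm_add_le (t g) v₀, ht g, hN v₀ (hVK hv₀)]
  have hrR : r < 2 * h + 1 + N := by linarith
  have hYD : DelaunaySet 2 Y r (2 * h + 1 + N) := ⟨hr Y fun x hx => hXZ x (hYX hx), hRY⟩
  have hXD : DelaunaySet 2 X r (2 * h + 1 + N) :=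
    ⟨hr X hXZ, fun z => (hRY z).mono (Set.inter_subset_inter_left _ hYX)⟩
  have hfin := finite_inter_closedBall hr₀ hXD.1
  have hsub (s) (hs : s ∈ T₀ ∪ T₁) : s ⊆ K ∧ s.Nonempty := by
    rcases Finset.mem_union.1 hs with hs | hs
    · exact ⟨(h₀ s hs).2.1.trans hVK, Finset.card_pos.1 (by rw [(h₀ s hs).1]; norm_num)⟩
    · refine ⟨?_, ⟨p, (h₁ s hs).2.2.1⟩⟩
      rw [← Finset.coe_subset, hKc]
      exact (h₁ s hs).2.1
  have hcard (v s) : (translateFinset v s).card = s.card := Finset.card_map _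
  obtain ⟨hd₀, hd₁⟩ := emptyTriangles_diff_eq hXgen hYX hfin hRY
    (T₀ := {s | ∃ g ∈ S, ∃ t ∈ T₀, translateFinset (pos g) t = s})
    (T₁ := {s | ∃ g ∈ S, ∃ t ∈ T₁, translateFinset (pos g) t = s})
    (by
      rintro _ ⟨g, hg, s, hs, rfl⟩
      obtain ⟨c, ρ, hc, hcN, hce⟩ := hT₀ s hs
      refine ⟨⟨(hcard _ _).trans (h₀ s hs).1, ?_, ?_⟩, ?_⟩
      · intro x hx
        obtain ⟨y, hy, rfl⟩ := mem_translateFinset.1 hx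
        exact ⟨g, y, (h₀ s hs).2.1 hy, rfl⟩
      · refine emptySimplex_translateFinset hN hfar (fun x hx => hXZ x (hYX hx)) hc hcN ?_
        rintro w hw ⟨g', w', hw', e⟩
        obtain rfl := hinj (hVK hw') hw e
        exact hce w (add_left_cancel e ▸ hw')
      · rintro ⟨-, -, he⟩
        refine (h₀ s hs).2.2.2 (emptySimplex_of_translateFinset ?_ he)
        rw [← hKc]
        exact fun w hw => hSX hg hw)
    (by
      rintro _ ⟨g, hg, s, hs, rfl⟩
      obtain ⟨c, ρ, hc, hcN, hce⟩ := hT₁ s hs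
      refine ⟨⟨(hcard _ _).trans (h₁ s hs).1, ?_, ?_⟩, ?_⟩
      · intro x hx
        obtain ⟨y, hy, rfl⟩ := mem_translateFinset.1 hx
        exact hSX hg ((hsub s (Finset.mem_union_right _ hs)).1 hy)
      · exact emptySimplex_translateFinset hN hfar hXZ hc hcN fun w hw _ => hce w hw
      · rintro ⟨-, hsY, -⟩
        exact hYp g (hsY (mem_translateFinset.2 ⟨p, (h₁ s hs).2.2.1, rfl⟩)))
    (by
      rintro _ ⟨g, hg, s, hs, rfl⟩ z hz
      obtain ⟨s', hs', hz'⟩ := hcov s hs _ (mem_convexHull_translateFinset.1 hz)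
      exact ⟨_, ⟨g, hg, s', hs', rfl⟩, mem_convexHull_translateFinset.2 hz'⟩)
    (by
      rintro q ⟨hqX | ⟨g, hg, rfl⟩, hqY⟩
      · exact absurd hqX hqY
      · have hcont : Tendsto (fun z => z - pos g) (nhds (pos g + p)) (nhds p) := by
          have : Continuous fun z => z - pos g := by fun_prop
          simpa using this.tendsto (pos g + p)
        filter_upwards [hcont.eventually hnhds] with z ⟨s, hs, hz⟩
        exact ⟨_, ⟨g, hg, s, hs, rfl⟩, mem_convexHull_translateFinset.2 hz⟩)
  let A (n : ℕ) : Finset (ℤ × ℤ) := (Finset.range (n + 1)).biUnion block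
  have hA (n : ℕ) (α : ℝ) (hα : 4 * h * 10 ^ n ≤ α) (hα' : α ≤ 8 * h * 10 ^ n) (g)
      (s) (hs : s ∈ T₀ ∪ T₁) : g ∈ A n ↔ g ∈ S ∧ translateFinset (pos g) s ∈ insideBall α := by
    have hw {j} (hj : g ∈ block j) (w) (hw : w ∈ K) : ‖pos g + w‖ ≤ α ↔ j ≤ n := by
      refine norm_le_iff_of_mem_block hj hh₀ ?_ hα hα'
      have e : pos g + w - h • latticePoint g = t g + w := by simp only [pos]; abel
      rw [e]
      linarith [norm_add_le (t g) w, ht g, hN w hw]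
    constructor
    · intro hg
      obtain ⟨j, hj, hgj⟩ := Finset.mem_biUnion.1 hg
      refine ⟨⟨j, hgj⟩, fun x hx => ?_⟩
      obtain ⟨w, hws, rfl⟩ := mem_translateFinset.1 hx
      rw [mem_closedBall_zero_iff, hw hgj w ((hsub s hs).1 hws)]
      exact Nat.lt_succ_iff.1 (Finset.mem_range.1 hj)
    · rintro ⟨⟨j, hj⟩, hin⟩
      obtain ⟨w, hws⟩ := (hsub s hs).2
      have := hin (mem_translateFinset.2 ⟨w, hws, rfl⟩)
      rw [mem_closedBall_zero_iff, hw hj w ((hsub s hs).1 hws)] at this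
      exact Finset.mem_biUnion.2 ⟨j, Finset.mem_range.2 (Nat.lt_succ_iff.2 this), hj⟩
  have hdiff (n : ℕ) (α : ℝ) (hα : 4 * h * 10 ^ n ≤ α) (hα' : α ≤ 8 * h * 10 ^ n) :=
    finsum_emptyTriangles_sub hYX hfin (fun g s => hinv (IsometryEquiv.addLeft (pos g)) s) hd₀ hd₁
      (hA n α hα hα') (fun g g' s hs s' hs' e => by
        obtain ⟨w, hw⟩ := (hsub s hs).2
        have : pos g + w ∈ translateFinset (pos g') s' :=
          e ▸ mem_translateFinset.2 ⟨w, hw, rfl⟩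
        obtain ⟨w', hw', e'⟩ := mem_translateFinset.1 this
        exact (hinj ((hsub s' hs').1 hw') ((hsub s hs).1 hw) e').symm)
  obtain ⟨l, hl⟩ := exists_tendsto_emptyTriangles hlim hr₀ hrR hXD hXgen
  obtain ⟨l', hl'⟩ := exists_tendsto_emptyTriangles hlim hr₀ hrR hYD hYgen
  have hpow (n : ℕ) : 0 < h * 10 ^ n := by positivity
  refine sub_eq_zero.1 (eq_zero_of_tendsto_density hl hl' (k := 4 * h) (by positivity)
    (a := fun n => ((A n).card : ℝ)) (fun n => ?_) (fun n => hdiff n _ le_rfl ?_)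
    (fun n => hdiff n _ ?_ ?_))
  · have hle : block n ⊆ A n := Finset.subset_biUnion_of_mem block (Finset.self_mem_range_succ n)
    have := Finset.card_le_card hle
    rw [card_block] at this
    exact_mod_cast this
  · linarith [hpow n]
  · linarith [hpow n]
  · linarith [hpow n]

end Exchange

/-- The power of the point `z` with respect to the circle through `(s, 0)` and `(t, 0)` whose
center has second coordinate `k / 2`. -/
def circlePower (s t k : ℝ) (z : EuclideanSpace ℝ (Fin 2)) : ℝ :=
  (z 0 - s) * (z 0 - t) + z 1 ^ 2 - k * z 1

theorem dist_sq_eq_circlePower (s t k : ℝ) (z : EuclideanSpace ℝ (Fin 2)) :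
    dist z !₂[(s + t) / 2, k / 2] ^ 2 =
      circlePower s t k z + (((s - t) / 2) ^ 2 + (k / 2) ^ 2) := by
  rw [dist_sq_eq_coords]
  simp only [circlePower, Matrix.cons_val_zero, Matrix.cons_val_one]
  ring

theorem emptySimplex_of_circlePower (s t k : ℝ) {τ : Finset (EuclideanSpace ℝ (Fin 2))}
    {X : Set (EuclideanSpace ℝ (Fin 2))} (hτ : ∀ v ∈ τ, circlePower s t k v = 0)
    (hX : ∀ x ∈ X, 0 ≤ circlePower s t k x) : EmptySimplex 2 τ X := by
  refine ⟨!₂[(s + t) / 2, k / 2], √(((s - t) / 2) ^ 2 + (k / 2) ^ 2), fun v hv => ?_,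
    fun x hx => ?_⟩
  · rw [← Real.sqrt_sq (dist_nonneg (x := v)), dist_sq_eq_circlePower, hτ v hv, zero_add]
  · rw [Real.sqrt_le_left dist_nonneg, dist_sq_eq_circlePower]
    linarith [hX x hx]

/-- Points `v` above and `w` below the first axis lie strictly outside of the circles through
`(s, 0)`, `(t, 0)` and the other point. -/
def StrictlySeparated (s t : ℝ) (v w : EuclideanSpace ℝ (Fin 2)) : Prop :=
  0 < v 1 * ((w 0 - s) * (w 0 - t) + w 1 ^ 2) - w 1 * ((v 0 - s) * (v 0 - t) + v 1 ^ 2)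

theorem emptySimplex_of_circlePower_pos {s t : ℝ} {v w : EuclideanSpace ℝ (Fin 2)}
    (hv : v 1 ≠ 0)
    (h : 0 < (v 1 * ((w 0 - s) * (w 0 - t) + w 1 ^ 2) -
      w 1 * ((v 0 - s) * (v 0 - t) + v 1 ^ 2)) * v 1)
    {X : Set (EuclideanSpace ℝ (Fin 2))}
    (hX : ∀ x ∈ X, (x 1 = 0 ∧ 0 ≤ (x 0 - s) * (x 0 - t)) ∨ x = v ∨ x = w) :
    EmptySimplex 2 {!₂[s, 0], !₂[t, 0], v} X := by
  have hk : circlePower s t (((v 0 - s) * (v 0 - t) + v 1 ^ 2) / v 1) v = 0 := by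
    rw [circlePower, div_mul_cancel₀ _ hv, sub_self]
  refine emptySimplex_of_circlePower s t (((v 0 - s) * (v 0 - t) + v 1 ^ 2) / v 1) ?_ ?_
  · simp only [Finset.mem_insert, Finset.mem_singleton, forall_eq_or_imp, forall_eq]
    exact ⟨by simp [circlePower], by simp [circlePower], hk⟩
  · intro x hx
    rcases hX x hx with ⟨h₁, h₂⟩ | rfl | rfl
    · simpa [circlePower, h₁] using h₂
    · exact hk.ge
    · have : circlePower s t (((v 0 - s) * (v 0 - t) + v 1 ^ 2) / v 1) x =
          ((v 1 * ((x 0 - s) * (x 0 - t) + x 1 ^ 2) -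
            x 1 * ((v 0 - s) * (v 0 - t) + v 1 ^ 2)) * v 1) / v 1 ^ 2 := by
        rw [circlePower]
        field_simp
      rw [this]
      positivity

theorem not_strictlySeparated_of_cocircular {s t ρ : ℝ} (hst : s ≠ t)
    {v w c : EuclideanSpace ℝ (Fin 2)} (hs : dist !₂[s, 0] c = ρ) (ht : dist !₂[t, 0] c = ρ)
    (hv : dist v c = ρ) (hw : dist w c = ρ) : ¬ StrictlySeparated s t v w := by
  have es := dist_sq_eq_coords !₂[s, 0] c
  have et := dist_sq_eq_coords !₂[t, 0] c
  have ev := dist_sq_eq_coords v c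
  have ew := dist_sq_eq_coords w c
  rw [hs] at es
  rw [ht] at et
  rw [hv] at ev
  rw [hw] at ew
  simp only [Matrix.cons_val_zero, Matrix.cons_val_one] at es et
  have hc : c 0 = (s + t) / 2 := by
    have : (s - t) * (c 0 - (s + t) / 2) = 0 := by linear_combination (es - et) / 2
    linarith [(mul_eq_zero.1 this).resolve_left (sub_ne_zero.2 hst)]
  rw [hc] at es ev ew
  refine fun h => h.ne' ?_
  linear_combination v 1 * (es - ew) - w 1 * (es - ev)

theorem dist_lt_of_chord {a b ρ : ℝ} (ha : 0 < a) (hb : 0 < b) {c : EuclideanSpace ℝ (Fin 2)}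
    (h₁ : dist !₂[-a, 0] c = ρ) (h₂ : dist !₂[b, 0] c = ρ) : dist !₂[0, 0] c < ρ := by
  have hρ : 0 ≤ ρ := h₁ ▸ dist_nonneg
  have e₁ := dist_sq_eq_coords !₂[-a, 0] c
  have e₂ := dist_sq_eq_coords !₂[b, 0] c
  have e := dist_sq_eq_coords !₂[0, 0] c
  rw [h₁] at e₁
  rw [h₂] at e₂
  simp only [Matrix.cons_val_zero, Matrix.cons_val_one] at e₁ e₂ e
  have hc : c 0 = (b - a) / 2 := by
    have : (a + b) * (c 0 - (b - a) / 2) = 0 := by linear_combination (e₂ - e₁) / 2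
    linarith [(mul_eq_zero.1 this).resolve_left (by positivity)]
  rw [hc] at e₁ e
  refine lt_of_pow_lt_pow_left₀ 2 hρ ?_
  rw [e, e₁]
  nlinarith [mul_pos ha hb]

theorem mem_convexHull_triangle {u v z : EuclideanSpace ℝ (Fin 2)} {lam mu : ℝ} (hl : 0 ≤ lam)
    (hm : 0 ≤ mu) (hlm : lam + mu ≤ 1) (hz : z = lam • u + mu • v) :
    z ∈ convexHull ℝ {u, (0 : EuclideanSpace ℝ (Fin 2)), v} := by
  rw [convexHull_insert (by simp), mem_convexJoin]
  rcases hlm.eq_or_lt with h | h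
  · refine ⟨u, rfl, v, subset_convexHull _ _ (by simp), ?_⟩
    exact ⟨lam, mu, hl, hm, h, hz.symm⟩
  by_cases h1 : lam = 1
  · refine ⟨u, rfl, v, subset_convexHull _ _ (by simp), ?_⟩
    exact ⟨lam, mu, hl, hm, by linarith, hz.symm⟩
  have hl1 : lam < 1 := by linarith
  refine ⟨u, rfl, (mu / (1 - lam)) • v, ?_, lam, 1 - lam, hl, by linarith, by ring, ?_⟩
  · rw [convexHull_pair]
    refine ⟨1 - mu / (1 - lam), mu / (1 - lam), ?_, by apply div_nonneg <;> linarith, by ring,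
      by simp⟩
    rw [sub_nonneg, div_le_one (by linarith)]
    linarith
  · rw [hz, smul_smul, mul_div_cancel₀ _ (by linarith)]

theorem eventually_mem_convexHull_triangles {a b : ℝ} (ha : 0 < a) (hb : 0 < b)
    {v : EuclideanSpace ℝ (Fin 2)} (hv : v 1 ≠ 0) :
    ∀ᶠ z in nhds (0 : EuclideanSpace ℝ (Fin 2)), 0 ≤ z 1 / v 1 →
      z ∈ convexHull ℝ {!₂[-a, 0], (0 : EuclideanSpace ℝ (Fin 2)), v} ∨
        z ∈ convexHull ℝ {!₂[b, 0], (0 : EuclideanSpace ℝ (Fin 2)), v} := by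
  have h₁ : ∀ᶠ z in nhds (0 : EuclideanSpace ℝ (Fin 2)),
      (z 0 - z 1 / v 1 * v 0) / b + z 1 / v 1 < 1 := by
    refine ContinuousAt.eventually_lt (Continuous.continuousAt (by fun_prop)) continuousAt_const ?_
    simp
  have h₂ : ∀ᶠ z in nhds (0 : EuclideanSpace ℝ (Fin 2)),
      -(z 0 - z 1 / v 1 * v 0) / a + z 1 / v 1 < 1 := by
    refine ContinuousAt.eventually_lt (Continuous.continuousAt (by fun_prop)) continuousAt_const ?_
    simp
  filter_upwards [h₁, h₂] with z h₁ h₂ hz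
  rcases le_total 0 (z 0 - z 1 / v 1 * v 0) with h | h
  · refine Or.inr (mem_convexHull_triangle (lam := (z 0 - z 1 / v 1 * v 0) / b) (by positivity)
      hz h₁.le (ext_coords ?_ ?_))
    · simp only [PiLp.add_apply, PiLp.smul_apply, smul_eq_mul, Matrix.cons_val_zero]
      field_simp
      ring
    · simp only [PiLp.add_apply, PiLp.smul_apply, smul_eq_mul, Matrix.cons_val_one,
        Matrix.cons_val_zero]
      field_simp
      ring
  · refine Or.inl (mem_convexHull_triangle (lam := -(z 0 - z 1 / v 1 * v 0) / a)
      (div_nonneg (by linarith) ha.le) hz h₂.le (ext_coords ?_ ?_))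
    · simp only [PiLp.add_apply, PiLp.smul_apply, smul_eq_mul, Matrix.cons_val_zero]
      field_simp
      ring
    · simp only [PiLp.add_apply, PiLp.smul_apply, smul_eq_mul, Matrix.cons_val_one,
        Matrix.cons_val_zero]
      field_simp
      ring

theorem generic_kite {a b : ℝ} (ha : 0 < a) (hb : 0 < b) {v w : EuclideanSpace ℝ (Fin 2)}
    (hv : 0 < v 1) (hw : w 1 < 0) (h : StrictlySeparated (-a) b v w)
    (hl : StrictlySeparated (-a) 0 v w) (hr : StrictlySeparated 0 b v w) :
    Generic 2 (insert !₂[0, 0]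
      (({!₂[-a, 0], !₂[b, 0], v, w} : Finset (EuclideanSpace ℝ (Fin 2))) :
        Set (EuclideanSpace ℝ (Fin 2)))) := by
  rintro Y hY ⟨c, ρ, hc⟩
  by_contra! hcard
  set K : Finset (EuclideanSpace ℝ (Fin 2)) := {!₂[0, 0], !₂[-a, 0], !₂[b, 0], v, w} with hK
  have hYK : Y ⊆ K := by
    rw [← Finset.coe_subset]
    refine hY.trans ?_
    simp [hK]
  have hK5 : K.card ≤ 5 := Finset.card_le_five
  have hmem (x y) (hx : x ∈ K) (hy : y ∈ K) (hxy : x ≠ y) (hxY : x ∉ Y) : y ∈ Y := by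
    by_contra hyY
    have hsub : Y ⊆ (K.erase x).erase y := fun z hz => Finset.mem_erase.2
      ⟨fun e => hyY (e ▸ hz), Finset.mem_erase.2 ⟨fun e => hxY (e ▸ hz), hYK hz⟩⟩
    have := Finset.card_le_card hsub
    rw [Finset.card_erase_of_mem (Finset.mem_erase.2 ⟨hxy.symm, hy⟩),
      Finset.card_erase_of_mem hx] at this
    omega
  have k0 : !₂[0, 0] ∈ K := by simp [hK]
  have k1 : !₂[-a, 0] ∈ K := by simp [hK]
  have k2 : !₂[b, 0] ∈ K := by simp [hK]
  have k3 : v ∈ K := by simp [hK]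
  have k4 : w ∈ K := by simp [hK]
  have n0 (x : EuclideanSpace ℝ (Fin 2)) {s t} (hst : x 0 = s) (hs : s ≠ t) : x ≠ !₂[t, 0] :=
    fun e => hs (by rw [← hst, e]; rfl)
  have n1 (t : ℝ) : !₂[t, 0] ≠ v := fun e => hv.ne (by rw [← e]; rfl)
  have n2 (t : ℝ) : !₂[t, 0] ≠ w := fun e => hw.ne (by rw [← e]; rfl)
  have n3 {s t : ℝ} (hst : s ≠ t) : (!₂[s, 0] : EuclideanSpace ℝ (Fin 2)) ≠ !₂[t, 0] :=
    n0 _ rfl hst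
  by_cases m0 : !₂[0, 0] ∈ Y
  · by_cases m1 : !₂[-a, 0] ∈ Y
    · by_cases m2 : !₂[b, 0] ∈ Y
      · exact (dist_lt_of_chord ha hb (hc _ m1) (hc _ m2)).ne (hc _ m0)
      · exact not_strictlySeparated_of_cocircular (by linarith) (hc _ m1) (hc _ m0)
          (hc _ (hmem _ _ k2 k3 (n1 b) m2)) (hc _ (hmem _ _ k2 k4 (n2 b) m2)) hl
    · exact not_strictlySeparated_of_cocircular hb.ne (hc _ m0)
          (hc _ (hmem _ _ k1 k2 (n3 (by linarith)) m1))
          (hc _ (hmem _ _ k1 k3 (n1 _) m1)) (hc _ (hmem _ _ k1 k4 (n2 _) m1)) hr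
  · exact not_strictlySeparated_of_cocircular (by linarith)
      (hc _ (hmem _ _ k0 k1 (n3 (by linarith)) m0)) (hc _ (hmem _ _ k0 k2 (n3 hb.ne) m0))
      (hc _ (hmem _ _ k0 k3 (n1 _) m0)) (hc _ (hmem _ _ k0 k4 (n2 _) m0)) h

section Exchange

variable {F : Finset (EuclideanSpace ℝ (Fin 2)) → ℝ}
  (hinv : ∀ (φ : EuclideanSpace ℝ (Fin 2) ≃ᵢ EuclideanSpace ℝ (Fin 2))
    (s : Finset (EuclideanSpace ℝ (Fin 2))), F (s.map φ.toEquiv.toEmbedding) = F s)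
  (hlim : ∀ (X : Set (EuclideanSpace ℝ (Fin 2))) (r R : ℝ), 0 < r → r < R →
    DelaunaySet 2 X r R → Generic 2 X →
    ∀ D : Geometry.SimplicialComplex ℝ (EuclideanSpace ℝ (Fin 2)),
      IsDelaunayTriangulation 2 D X →
      ∃ l : ℝ, Tendsto (fun α : ℝ =>
        (∑ᶠ s ∈ {s : Finset (EuclideanSpace ℝ (Fin 2)) |
            s ∈ D.faces ∧ s.card = 3 ∧
              (s : Set (EuclideanSpace ℝ (Fin 2))) ⊆ closedBall 0 α}, F s) /
        (volume (closedBall (0 : EuclideanSpace ℝ (Fin 2)) α)).toReal) atTop (nhds l))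

/-- The defect of additivity of `F` when the base of a triangle is split at the origin. -/
def splitDefect (F : Finset (EuclideanSpace ℝ (Fin 2)) → ℝ) (a b : ℝ)
    (v : EuclideanSpace ℝ (Fin 2)) : ℝ :=
  F {!₂[-a, 0], !₂[0, 0], v} + F {!₂[0, 0], !₂[b, 0], v} - F {!₂[-a, 0], !₂[b, 0], v}

include hinv hlim in
theorem splitDefect_add_splitDefect {a b : ℝ} (ha : 0 < a) (hb : 0 < b)
    {v w : EuclideanSpace ℝ (Fin 2)} (hv : 0 < v 1) (hw : w 1 < 0)
    (h : StrictlySeparated (-a) b v w) (hl : StrictlySeparated (-a) 0 v w)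
    (hr : StrictlySeparated 0 b v w) : splitDefect F a b v + splitDefect F a b w = 0 := by
  classical
  have n1 (t : ℝ) : !₂[t, 0] ≠ v := fun e => hv.ne (by rw [← e]; rfl)
  have n2 (t : ℝ) : !₂[t, 0] ≠ w := fun e => hw.ne (by rw [← e]; rfl)
  have n3 {s t : ℝ} (hst : s ≠ t) : (!₂[s, 0] : EuclideanSpace ℝ (Fin 2)) ≠ !₂[t, 0] :=
    fun e => hst (congrArg (fun x : EuclideanSpace ℝ (Fin 2) => x 0) e)
  have nvw : v ≠ w := fun e => by rw [e] at hv; linarith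
  have nab := n3 (show -a ≠ b by linarith)
  have na0 := n3 (show -a ≠ 0 by linarith)
  have n0b := n3 hb.ne
  have hcard (s t) (hst : s ≠ t) (u : EuclideanSpace ℝ (Fin 2)) (hu : ∀ t, !₂[t, 0] ≠ u) :
      ({!₂[s, 0], !₂[t, 0], u} : Finset (EuclideanSpace ℝ (Fin 2))).card = 3 :=
    Finset.card_eq_three.2 ⟨_, _, _, n3 hst, hu s, hu t, rfl⟩
  have hnot (s : Finset (EuclideanSpace ℝ (Fin 2))) (h₁ : !₂[-a, 0] ∈ s) (h₂ : !₂[b, 0] ∈ s)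
      (X : Set (EuclideanSpace ℝ (Fin 2))) (hX : !₂[0, 0] ∈ X) : ¬ EmptySimplex 2 s X := by
    rintro ⟨c, ρ, hs, hc⟩
    exact (dist_lt_of_chord ha hb (hs _ h₁) (hs _ h₂)).not_ge (hc _ hX)
  have hflip {s t} (hst : StrictlySeparated s t v w) :
      0 < (w 1 * ((v 0 - s) * (v 0 - t) + v 1 ^ 2) -
        v 1 * ((w 0 - s) * (w 0 - t) + w 1 ^ 2)) * w 1 := by
    refine mul_pos_of_neg_of_neg ?_ hw
    rw [StrictlySeparated] at hst
    linarith
  have hnn {s t} (hs : -a ≤ s) (ht : t ≤ b) (hs0 : s ≤ 0) (ht0 : 0 ≤ t) :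
      0 ≤ (-a - s) * (-a - t) ∧ 0 ≤ (b - s) * (b - t) :=
    ⟨mul_nonneg_of_nonpos_of_nonpos (by linarith) (by linarith),
      mul_nonneg (by linarith) (by linarith)⟩
  have hemp {s t} (hst : StrictlySeparated s t v w) {X : Set (EuclideanSpace ℝ (Fin 2))}
      (hX : ∀ x ∈ X, (x 1 = 0 ∧ 0 ≤ (x 0 - s) * (x 0 - t)) ∨ x = v ∨ x = w) :
      EmptySimplex 2 {!₂[s, 0], !₂[t, 0], v} X ∧ EmptySimplex 2 {!₂[s, 0], !₂[t, 0], w} X :=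
    ⟨emptySimplex_of_circlePower_pos hv.ne' (mul_pos hst hv) hX,
      emptySimplex_of_circlePower_pos hw.ne (hflip hst) fun x hx => (hX x hx).imp_right Or.symm⟩
  have e₀ := hemp h (X := (({!₂[-a, 0], !₂[b, 0], v, w} : Finset (EuclideanSpace ℝ (Fin 2))) :
        Set (EuclideanSpace ℝ (Fin 2)))) (by
    intro x hx
    simp only [Finset.coe_insert, Finset.coe_singleton, Set.mem_insert_iff,
      Set.mem_singleton_iff] at hx
    rcases hx with rfl | rfl | rfl | rfl
    · exact Or.inl ⟨rfl, by simp⟩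
    · exact Or.inl ⟨rfl, by simp⟩
    · exact Or.inr (Or.inl rfl)
    · exact Or.inr (Or.inr rfl))
  have e₁ {s t} (hst : StrictlySeparated s t v w) (hs : -a ≤ s) (ht : t ≤ b) (hs0 : s ≤ 0)
      (ht0 : 0 ≤ t) (hprod : s * t = 0) := hemp hst (X := insert !₂[0, 0]
        (({!₂[-a, 0], !₂[b, 0], v, w} : Finset (EuclideanSpace ℝ (Fin 2))) :
        Set (EuclideanSpace ℝ (Fin 2)))) (by
    intro x hx
    simp only [Finset.coe_insert, Finset.coe_singleton, Set.mem_insert_iff,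
      Set.mem_singleton_iff] at hx
    rcases hx with rfl | rfl | rfl | rfl | rfl
    · exact Or.inl ⟨rfl, by simp [hprod]⟩
    · exact Or.inl ⟨rfl, (hnn hs ht hs0 ht0).1⟩
    · exact Or.inl ⟨rfl, (hnn hs ht hs0 ht0).2⟩
    · exact Or.inr (Or.inl rfl)
    · exact Or.inr (Or.inr rfl))
  have eL := e₁ hl le_rfl hb.le (by linarith) le_rfl (by simp)
  have eR := e₁ hr (by linarith) le_rfl le_rfl hb.le (by simp)
  have h0seg : (!₂[0, 0] : EuclideanSpace ℝ (Fin 2)) ∈ segment ℝ !₂[-a, 0] !₂[b, 0] := by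
    refine ⟨b / (a + b), a / (a + b), by positivity, by positivity, ?_, ext_coords ?_ ?_⟩
    · field_simp
      ring
    · simp only [PiLp.add_apply, PiLp.smul_apply, smul_eq_mul, Matrix.cons_val_zero]
      field_simp
      ring
    · simp
  have hsubset (x u : EuclideanSpace ℝ (Fin 2)) (hx : x = !₂[-a, 0] ∨ x = !₂[b, 0]) :
      convexHull ℝ {x, !₂[0, 0], u} ⊆ convexHull ℝ {!₂[-a, 0], !₂[b, 0], u} := by
    refine convexHull_min ?_ (convex_convexHull ℝ _)
    have i1 : !₂[-a, 0] ∈ convexHull ℝ {!₂[-a, 0], !₂[b, 0], u} :=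
      subset_convexHull _ _ (by simp)
    have i2 : !₂[b, 0] ∈ convexHull ℝ {!₂[-a, 0], !₂[b, 0], u} :=
      subset_convexHull _ _ (by simp)
    rintro y (rfl | rfl | rfl)
    · rcases hx with rfl | rfl
      exacts [i1, i2]
    · exact (convex_convexHull ℝ _).segment_subset i1 i2 h0seg
    · exact subset_convexHull _ _ (by simp)
  have hzero : (!₂[0, 0] : EuclideanSpace ℝ (Fin 2)) = 0 := ext_coords rfl rfl
  have key := sum_eq_sum_of_exchange hinv hlim
    (V := {!₂[-a, 0], !₂[b, 0], v, w}) (p := !₂[0, 0])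
    (T₀ := {{!₂[-a, 0], !₂[b, 0], v}, {!₂[-a, 0], !₂[b, 0], w}})
    (T₁ := {{!₂[-a, 0], !₂[0, 0], v}, {!₂[0, 0], !₂[b, 0], v}, {!₂[-a, 0], !₂[0, 0], w},
      {!₂[0, 0], !₂[b, 0], w}})
    ⟨v, by simp⟩ (by
      simp only [Finset.mem_insert, Finset.mem_singleton, not_or]
      exact ⟨na0.symm, n0b, n1 0, n2 0⟩)
    (generic_kite ha hb hv hw h hl hr) (by
      simp only [Finset.mem_insert, Finset.mem_singleton, forall_eq_or_imp, forall_eq]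
      refine ⟨⟨hcard _ _ (by linarith) _ n1, ?_, e₀.1, hnot _ (by simp) (by simp) _ (by simp)⟩,
        ⟨hcard _ _ (by linarith) _ n2, ?_, e₀.2, hnot _ (by simp) (by simp) _ (by simp)⟩⟩
      · intro x
        simp only [Finset.mem_insert, Finset.mem_singleton]
        tauto
      · intro x
        simp only [Finset.mem_insert, Finset.mem_singleton]
        tauto) (by
      have hsub (s : Finset (EuclideanSpace ℝ (Fin 2)))
          (hs : s ⊆ {!₂[0, 0], !₂[-a, 0], !₂[b, 0], v, w}) :
          (s : Set (EuclideanSpace ℝ (Fin 2))) ⊆ insert !₂[0, 0]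
            (({!₂[-a, 0], !₂[b, 0], v, w} : Finset (EuclideanSpace ℝ (Fin 2))) :
              Set (EuclideanSpace ℝ (Fin 2))) := by
        rw [← Finset.coe_insert]
        exact Finset.coe_subset.2 hs
      simp only [Finset.mem_insert, Finset.mem_singleton, forall_eq_or_imp, forall_eq]
      refine ⟨⟨hcard _ _ (by linarith) _ n1, hsub _ ?_, by simp, eL.1⟩,
        ⟨hcard _ _ hb.ne _ n1, hsub _ ?_, by simp, eR.1⟩,
        ⟨hcard _ _ (by linarith) _ n2, hsub _ ?_, by simp, eL.2⟩,
        ⟨hcard _ _ hb.ne _ n2, hsub _ ?_, by simp, eR.2⟩⟩ <;>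
      · intro x
        simp only [Finset.mem_insert, Finset.mem_singleton]
        tauto) (by
      simp only [Finset.mem_insert, Finset.mem_singleton, forall_eq_or_imp, forall_eq,
        exists_eq_or_imp, exists_eq_left, Finset.coe_insert, Finset.coe_singleton]
      refine ⟨fun z hz => Or.inl (hsubset _ _ (Or.inl rfl) hz), fun z hz => Or.inl ?_,
        fun z hz => Or.inr (hsubset _ _ (Or.inl rfl) hz), fun z hz => Or.inr ?_⟩
      · rw [Set.insert_comm] at hz
        exact hsubset _ _ (Or.inr rfl) hz
      · rw [Set.insert_comm] at hz
        exact hsubset _ _ (Or.inr rfl) hz) (by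
      simp only [Finset.mem_insert, Finset.mem_singleton,
        exists_eq_or_imp, exists_eq_left, Finset.coe_insert, Finset.coe_singleton]
      rw [hzero, Set.insert_comm 0, Set.insert_comm 0]
      filter_upwards [eventually_mem_convexHull_triangles ha hb hv.ne',
        eventually_mem_convexHull_triangles ha hb hw.ne] with z hz hz'
      rcases le_total 0 (z 1) with hpos | hneg
      · have := hz (div_nonneg hpos hv.le)
        tauto
      · have := hz' (div_nonneg_of_nonpos hneg hw.le)
        tauto)
  have d₁ {A B : Finset (EuclideanSpace ℝ (Fin 2))} (x) (hA : x ∈ A) (hB : x ∉ B) : A ≠ B :=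
    fun e => hB (e ▸ hA)
  rw [Finset.sum_insert, Finset.sum_insert, Finset.sum_insert, Finset.sum_singleton,
    Finset.sum_insert, Finset.sum_singleton] at key
  · simp only [splitDefect]
    linarith
  · rw [Finset.mem_singleton]
    exact d₁ v (by simp) (by simp [(n1 _).symm, nvw])
  · rw [Finset.mem_singleton]
    exact d₁ !₂[-a, 0] (by simp) (by simp [-WithLp.toLp.injEq, na0, nab, n2])
  · simp only [Finset.mem_insert, Finset.mem_singleton, not_or]
    exact ⟨d₁ v (by simp) (by simp [(n1 _).symm, nvw]), d₁ v (by simp) (by simp [(n1 _).symm, nvw])⟩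
  · simp only [Finset.mem_insert, Finset.mem_singleton, not_or]
    exact ⟨d₁ !₂[-a, 0] (by simp) (by simp [-WithLp.toLp.injEq, na0, nab, n1]),
      d₁ v (by simp) (by simp [(n1 _).symm, nvw]),
      d₁ v (by simp) (by simp [(n1 _).symm, nvw])⟩

end Exchange

/-- The isometry of the plane given by `o` and the orthogonal matrix with rows `(c, -ε s)` and
`(s, ε c)`. -/
def planeIsometry (o : EuclideanSpace ℝ (Fin 2)) (c s ε : ℝ) (h : c ^ 2 + s ^ 2 = 1)
    (hε : ε ^ 2 = 1) : EuclideanSpace ℝ (Fin 2) ≃ᵢ EuclideanSpace ℝ (Fin 2) :=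
  IsometryEquiv.mk'
    (fun z => !₂[o 0 + c * z 0 - ε * s * z 1, o 1 + s * z 0 + ε * c * z 1])
    (fun z => !₂[c * (z 0 - o 0) + s * (z 1 - o 1), ε * (c * (z 1 - o 1) - s * (z 0 - o 0))])
    (fun z => by
      apply ext_coords
      · simp only [Matrix.cons_val_zero, Matrix.cons_val_one]
        linear_combination (z 0 - o 0) * h - s * (c * (z 1 - o 1) - s * (z 0 - o 0)) * hε
      · simp only [Matrix.cons_val_zero, Matrix.cons_val_one]
        linear_combination (z 1 - o 1) * h + c * (c * (z 1 - o 1) - s * (z 0 - o 0)) * hε)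
    (Isometry.of_dist_eq fun x y => by
      rw [← Real.sqrt_sq dist_nonneg, ← Real.sqrt_sq (dist_nonneg (x := x) (y := y)),
        dist_sq_eq_coords, dist_sq_eq_coords]
      congr 1
      simp only [Matrix.cons_val_zero, Matrix.cons_val_one]
      linear_combination ((x 0 - y 0) ^ 2 + ε ^ 2 * (x 1 - y 1) ^ 2) * h + (x 1 - y 1) ^ 2 * hε)

theorem planeIsometry_apply (o : EuclideanSpace ℝ (Fin 2)) (c s ε : ℝ) (h : c ^ 2 + s ^ 2 = 1)
    (hε : ε ^ 2 = 1) (z : EuclideanSpace ℝ (Fin 2)) : planeIsometry o c s ε h hε z =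
      !₂[o 0 + c * z 0 - ε * s * z 1, o 1 + s * z 0 + ε * c * z 1] := rfl

section Invariant

variable {F : Finset (EuclideanSpace ℝ (Fin 2)) → ℝ}
  (hinv : ∀ (φ : EuclideanSpace ℝ (Fin 2) ≃ᵢ EuclideanSpace ℝ (Fin 2))
    (s : Finset (EuclideanSpace ℝ (Fin 2))), F (s.map φ.toEquiv.toEmbedding) = F s)

include hinv in
theorem apply_isometry (φ : EuclideanSpace ℝ (Fin 2) ≃ᵢ EuclideanSpace ℝ (Fin 2))
    (x y z : EuclideanSpace ℝ (Fin 2)) : F {φ x, φ y, φ z} = F {x, y, z} := by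
  rw [← hinv φ {x, y, z}, Finset.map_insert, Finset.map_insert, Finset.map_singleton]
  rfl

include hinv in
theorem splitDefect_mirror (a b x y : ℝ) :
    splitDefect F a b !₂[x, -y] = splitDefect F a b !₂[x, y] := by
  have h (z t : ℝ) : F {!₂[z, 0], !₂[t, 0], !₂[x, -y]} = F {!₂[z, 0], !₂[t, 0], !₂[x, y]} := by
    rw [← apply_isometry hinv (planeIsometry 0 1 0 (-1) (by norm_num) (by norm_num))
      !₂[z, 0] !₂[t, 0] !₂[x, y]]
    simp [planeIsometry_apply]
  rw [splitDefect, splitDefect, h, h, h]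

variable (hlim : ∀ (X : Set (EuclideanSpace ℝ (Fin 2))) (r R : ℝ), 0 < r → r < R →
    DelaunaySet 2 X r R → Generic 2 X →
    ∀ D : Geometry.SimplicialComplex ℝ (EuclideanSpace ℝ (Fin 2)),
      IsDelaunayTriangulation 2 D X →
      ∃ l : ℝ, Tendsto (fun α : ℝ =>
        (∑ᶠ s ∈ {s : Finset (EuclideanSpace ℝ (Fin 2)) |
            s ∈ D.faces ∧ s.card = 3 ∧
              (s : Set (EuclideanSpace ℝ (Fin 2))) ⊆ closedBall 0 α}, F s) /
        (volume (closedBall (0 : EuclideanSpace ℝ (Fin 2)) α)).toReal) atTop (nhds l))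

theorem eventually_strictlySeparated (s t : ℝ) {v : EuclideanSpace ℝ (Fin 2)} (hv : 0 < v 1) :
    ∀ᶠ y in atTop, StrictlySeparated s t v !₂[0, -y] := by
  have h₁ : Tendsto (fun y : ℝ => v 1 * y + ((v 0 - s) * (v 0 - t) + v 1 ^ 2)) atTop atTop :=
    tendsto_atTop_add_const_right _ _ (tendsto_id.const_mul_atTop hv)
  have h₂ := tendsto_id.atTop_mul_atTop₀ h₁
  filter_upwards [h₂.eventually_gt_atTop (-(v 1 * (s * t)))] with y hy
  simp only [id] at hy
  simp only [StrictlySeparated, Matrix.cons_val_zero, Matrix.cons_val_one]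
  linarith

include hinv hlim in
theorem splitDefect_eq_zero {a b : ℝ} (ha : 0 < a) (hb : 0 < b)
    {v : EuclideanSpace ℝ (Fin 2)} (hv : 0 < v 1) : splitDefect F a b v = 0 := by
  have hsep (s t : ℝ) : ∀ᶠ y in atTop, StrictlySeparated s t !₂[0, y] !₂[0, -y] := by
    filter_upwards [eventually_gt_atTop 0, eventually_gt_atTop 1,
      eventually_gt_atTop (-(s * t))] with y h₀ h₁ h₂
    simp only [StrictlySeparated, Matrix.cons_val_zero, Matrix.cons_val_one]
    have : 0 < 2 * y * (s * t + y ^ 2) := mul_pos (by linarith) (by nlinarith)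
    linarith
  obtain ⟨y, hy⟩ := ((eventually_gt_atTop (0 : ℝ)).and
    (((eventually_strictlySeparated (-a) b hv).and ((eventually_strictlySeparated (-a) 0 hv).and
      (eventually_strictlySeparated 0 b hv))).and
      ((hsep (-a) b).and ((hsep (-a) 0).and (hsep 0 b))))).exists
  obtain ⟨hy, ⟨h₁, h₂, h₃⟩, h₄, h₅, h₆⟩ := hy
  have e₁ := splitDefect_add_splitDefect hinv hlim ha hb hv (w := !₂[0, -y]) (by simpa using hy)
    h₁ h₂ h₃
  have e₂ := splitDefect_add_splitDefect hinv hlim ha hb (v := !₂[0, y]) (w := !₂[0, -y])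
    (by simpa using hy) (by simpa using hy) h₄ h₅ h₆
  rw [splitDefect_mirror hinv] at e₁ e₂
  linarith

include hinv hlim in
/-- `F` is additive when a side of a triangle is subdivided. -/
theorem apply_eq_add_of_split {u v w p : EuclideanSpace ℝ (Fin 2)} {lam : ℝ} (h₀ : 0 < lam)
    (h₁ : lam < 1) (hp₀ : p 0 = u 0 + lam * (v 0 - u 0)) (hp₁ : p 1 = u 1 + lam * (v 1 - u 1))
    (hw : (v 0 - u 0) * (w 1 - u 1) - (v 1 - u 1) * (w 0 - u 0) ≠ 0) :
    F {u, v, w} = F {u, p, w} + F {p, v, w} := by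
  set d₀ := v 0 - u 0 with hd₀
  set d₁ := v 1 - u 1 with hd₁
  have hd : 0 < d₀ ^ 2 + d₁ ^ 2 := by
    by_contra! hle
    have e₀ : d₀ = 0 := by nlinarith
    have e₁ : d₁ = 0 := by nlinarith
    simp [e₀, e₁] at hw
  set L := √(d₀ ^ 2 + d₁ ^ 2) with hL
  have hL0 : 0 < L := Real.sqrt_pos.2 hd
  have hL2 : L ^ 2 = d₀ ^ 2 + d₁ ^ 2 := Real.sq_sqrt hd.le
  obtain ⟨ε, hε, hεpos⟩ : ∃ ε : ℝ, ε ^ 2 = 1 ∧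
      0 < ε * (d₀ * (w 1 - u 1) - d₁ * (w 0 - u 0)) := by
    rcases hw.lt_or_gt with h | h
    · exact ⟨-1, by norm_num, by linarith⟩
    · exact ⟨1, by norm_num, by linarith⟩
  have hcs : (d₀ / L) ^ 2 + (d₁ / L) ^ 2 = 1 := by
    rw [div_pow, div_pow, ← add_div, hL2, div_self hd.ne']
  set φ := planeIsometry p (d₀ / L) (d₁ / L) ε hcs hε with hφ
  have hv0 : v 0 = u 0 + d₀ := by rw [hd₀]; ring
  have hv1 : v 1 = u 1 + d₁ := by rw [hd₁]; ring
  have eu : φ !₂[-(lam * L), 0] = u := by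
    rw [hφ, planeIsometry_apply]
    apply ext_coords
    · simp only [Matrix.cons_val_zero, Matrix.cons_val_one, hp₀]
      field_simp
      ring
    · simp only [Matrix.cons_val_zero, Matrix.cons_val_one, hp₁]
      field_simp
      ring
  have ev : φ !₂[(1 - lam) * L, 0] = v := by
    rw [hφ, planeIsometry_apply]
    apply ext_coords
    · simp only [Matrix.cons_val_zero, Matrix.cons_val_one, hp₀, hv0]
      field_simp
      ring
    · simp only [Matrix.cons_val_zero, Matrix.cons_val_one, hp₁, hv1]
      field_simp
      ring
  have ep : φ !₂[0, 0] = p := by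
    rw [hφ, planeIsometry_apply]
    apply ext_coords <;> simp
  have hz : 0 < (φ.symm w) 1 := by
    have hw₁ : (φ.symm w) 1 = ε * (d₀ / L * (w 1 - p 1) - d₁ / L * (w 0 - p 0)) := rfl
    rw [hw₁]
    have : ε * (d₀ / L * (w 1 - p 1) - d₁ / L * (w 0 - p 0)) =
        ε * (d₀ * (w 1 - u 1) - d₁ * (w 0 - u 0)) / L := by
      rw [hp₀, hp₁]
      field_simp
      ring
    rw [this]
    positivity
  have key := splitDefect_eq_zero hinv hlim (a := lam * L) (b := (1 - lam) * L) (by positivity)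
    (mul_pos (by linarith) hL0) hz
  rw [splitDefect, ← apply_isometry hinv φ, ← apply_isometry hinv φ !₂[0, 0],
    ← apply_isometry hinv φ _ !₂[(1 - lam) * L, 0], eu, ev, ep, φ.apply_symm_apply] at key
  linarith

end Invariant

theorem eq_mul_of_additive_of_bounded {f : ℝ → ℝ}
    (hadd : ∀ x y, 0 < x → 0 < y → f (x + y) = f x + f y) {B : ℝ}
    (hB : ∀ x, 1 ≤ x → x ≤ 2 → |f x| ≤ B) {x : ℝ} (hx : 0 < x) : f x = x * f 1 := by
  have hshift (n : ℕ) (y : ℝ) (hy : 0 < y) : f (y + n) = f y + n * f 1 := by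
    induction n with
    | zero => simp
    | succ n ih =>
      rw [Nat.cast_succ, ← add_assoc, hadd _ _ (by positivity) one_pos, ih]
      ring
  have hbdd (y : ℝ) (hy : 0 < y) : |f y - y * f 1| ≤ B + 2 * |f 1| := by
    have main (z : ℝ) (h₁ : 1 ≤ z) (h₂ : z ≤ 2) : |f z - z * f 1| ≤ B + 2 * |f 1| := by
      refine (abs_sub _ _).trans (add_le_add (hB z h₁ h₂) ?_)
      rw [abs_mul, abs_of_pos (by linarith : 0 < z)]
      gcongr
    rcases lt_or_ge y 1 with h | h
    · have h₁ := main (y + 1) (by linarith) (by linarith)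
      rw [hadd y 1 hy one_pos] at h₁
      convert h₁ using 2
      ring
    · have hfl : 1 ≤ ⌊y⌋₊ := Nat.one_le_floor_iff y |>.2 h
      have hle := Nat.floor_le hy.le
      have hlt := Nat.lt_floor_add_one y
      set n := ⌊y⌋₊ - 1 with hn
      have hcast : (⌊y⌋₊ : ℝ) = n + 1 := by
        rw [hn, Nat.cast_sub hfl]
        simp
      rw [hcast] at hle hlt
      have h₁ := main (y - n) (by linarith) (by linarith)
      have h₂ := hshift n (y - n) (by linarith)
      rw [sub_add_cancel] at h₂
      rw [h₂]
      convert h₁ using 2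
      ring
  have hmul (n : ℕ) : f ((n + 1) * x) = (n + 1) * f x := by
    induction n with
    | zero => simp
    | succ n ih =>
      rw [Nat.cast_succ, add_mul, one_mul, hadd _ _ (by positivity) hx, ih]
      ring
  by_contra hne
  have hpos : 0 < |f x - x * f 1| := abs_pos.2 (sub_ne_zero.2 hne)
  obtain ⟨n, hn⟩ := exists_nat_gt ((B + 2 * |f 1|) / |f x - x * f 1|)
  rw [div_lt_iff₀ hpos] at hn
  have h := hbdd ((n + 1) * x) (by positivity)
  have e : f ((n + 1) * x) - (n + 1) * x * f 1 = (n + 1) * (f x - x * f 1) := by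
    rw [hmul]
    ring
  rw [e, abs_mul, abs_of_pos (by positivity)] at h
  linarith

/-- The value of `F` on a right triangle with horizontal leg `y` and vertical leg `h`. -/
def rightValue (F : Finset (EuclideanSpace ℝ (Fin 2)) → ℝ) (h y : ℝ) : ℝ :=
  F {!₂[0, 0], !₂[y, 0], !₂[0, h]}

section Invariant

variable {F : Finset (EuclideanSpace ℝ (Fin 2)) → ℝ}
  (hinv : ∀ (φ : EuclideanSpace ℝ (Fin 2) ≃ᵢ EuclideanSpace ℝ (Fin 2))
    (s : Finset (EuclideanSpace ℝ (Fin 2))), F (s.map φ.toEquiv.toEmbedding) = F s)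

theorem apply_swap (x y z : EuclideanSpace ℝ (Fin 2)) : F {x, y, z} = F {y, x, z} := by
  rw [Finset.insert_comm]

theorem apply_rotate (x y z : EuclideanSpace ℝ (Fin 2)) : F {x, y, z} = F {y, z, x} := by
  rw [Finset.insert_comm, Finset.pair_comm x z]

include hinv in
theorem apply_eq_rightValue {p q p' q' h y : ℝ} (hp : |p' - p| = y) (hq : |q' - q| = h) :
    F {!₂[p, q], !₂[p', q], !₂[p, q']} = rightValue F h y := by
  have key (ε η : ℝ) (hε : ε ^ 2 = 1) (hη : η ^ 2 = 1) (hp : p' = p + ε * y)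
      (hq : q' = q + η * h) : F {!₂[p, q], !₂[p', q], !₂[p, q']} = rightValue F h y := by
    have e := apply_isometry hinv (planeIsometry !₂[p, q] ε 0 (ε * η) (by simpa using hε)
      (by rw [mul_pow, hε, hη, one_mul])) !₂[0, 0] !₂[y, 0] !₂[0, h]
    simp only [planeIsometry_apply, Matrix.cons_val_zero, Matrix.cons_val_one, mul_zero, sub_zero,
      add_zero, zero_mul] at e
    rw [show ε * η * ε * h = η * h by linear_combination η * h * hε, ← hp, ← hq] at e
    exact e
  rcases abs_cases (p' - p) with ⟨h₁, -⟩ | ⟨h₁, -⟩ <;>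
    rcases abs_cases (q' - q) with ⟨h₂, -⟩ | ⟨h₂, -⟩
  · exact key 1 1 (by norm_num) (by norm_num) (by linarith) (by linarith)
  · exact key 1 (-1) (by norm_num) (by norm_num) (by linarith) (by linarith)
  · exact key (-1) 1 (by norm_num) (by norm_num) (by linarith) (by linarith)
  · exact key (-1) (-1) (by norm_num) (by norm_num) (by linarith) (by linarith)

include hinv in
theorem rightValue_comm (h y : ℝ) : rightValue F h y = rightValue F y h := by
  have e := apply_isometry hinv (planeIsometry 0 0 1 (-1) (by norm_num) (by norm_num))
      !₂[0, 0] !₂[y, 0] !₂[0, h]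
  simp only [planeIsometry_apply, Matrix.cons_val_zero, Matrix.cons_val_one, mul_zero, sub_zero,
    add_zero, zero_mul, PiLp.zero_apply, mul_one, one_mul, neg_mul, sub_neg_eq_add, zero_add] at e
  rw [rightValue, rightValue, ← e, Finset.pair_comm]

variable (hlim : ∀ (X : Set (EuclideanSpace ℝ (Fin 2))) (r R : ℝ), 0 < r → r < R →
    DelaunaySet 2 X r R → Generic 2 X →
    ∀ D : Geometry.SimplicialComplex ℝ (EuclideanSpace ℝ (Fin 2)),
      IsDelaunayTriangulation 2 D X →
      ∃ l : ℝ, Tendsto (fun α : ℝ =>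
        (∑ᶠ s ∈ {s : Finset (EuclideanSpace ℝ (Fin 2)) |
            s ∈ D.faces ∧ s.card = 3 ∧
              (s : Set (EuclideanSpace ℝ (Fin 2))) ⊆ closedBall 0 α}, F s) /
        (volume (closedBall (0 : EuclideanSpace ℝ (Fin 2)) α)).toReal) atTop (nhds l))

include hinv hlim in
theorem rightValue_add {h x y : ℝ} (hh : 0 < h) (hx : 0 < x) (hy : 0 < y) :
    rightValue F h (x + y) = rightValue F h x + rightValue F h y := by
  have hxy : 0 < x + y := by positivity
  have split {u₀ u₁ v₀ v₁ w₀ w₁ p₀ p₁ : ℝ} (lam : ℝ) (h₀ : 0 < lam) (h₁ : lam < 1)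
      (hp₀ : p₀ = u₀ + lam * (v₀ - u₀)) (hp₁ : p₁ = u₁ + lam * (v₁ - u₁))
      (hw : (v₀ - u₀) * (w₁ - u₁) - (v₁ - u₁) * (w₀ - u₀) ≠ 0) :
      F {!₂[u₀, u₁], !₂[v₀, v₁], !₂[w₀, w₁]} = F {!₂[u₀, u₁], !₂[p₀, p₁], !₂[w₀, w₁]} +
        F {!₂[p₀, p₁], !₂[v₀, v₁], !₂[w₀, w₁]} :=
    apply_eq_add_of_split hinv hlim h₀ h₁ hp₀ hp₁ hw
  have l₁ : x / (x + y) < 1 := by rw [div_lt_one hxy]; linarith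
  have l₂ : y / (x + y) < 1 := by rw [div_lt_one hxy]; linarith
  have hhx := mul_pos hh hx
  have hhy := mul_pos hh hy
  have s₁ := split (u₀ := 0) (u₁ := 0) (v₀ := x + y) (v₁ := 0) (w₀ := 0) (w₁ := h) (p₀ := x)
    (p₁ := 0) (x / (x + y)) (by positivity) l₁ (by field_simp; ring) (by ring)
    (by apply ne_of_gt; linarith)
  have s₂ := split (u₀ := 0) (u₁ := h) (v₀ := x + y) (v₁ := h) (w₀ := x + y) (w₁ := 0) (p₀ := x)
    (p₁ := h) (x / (x + y)) (by positivity) l₁ (by field_simp; ring) (by ring)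
    (by apply ne_of_lt; linarith)
  have s₃ := split (u₀ := x + y) (u₁ := 0) (v₀ := 0) (v₁ := h) (w₀ := x) (w₁ := 0) (p₀ := x)
    (p₁ := h * y / (x + y)) (y / (x + y)) (by positivity) l₂ (by field_simp; ring)
    (by field_simp; ring) (by apply ne_of_gt; linarith)
  have s₄ := split (u₀ := x + y) (u₁ := 0) (v₀ := 0) (v₁ := h) (w₀ := x) (w₁ := h) (p₀ := x)
    (p₁ := h * y / (x + y)) (y / (x + y)) (by positivity) l₂ (by field_simp; ring)
    (by field_simp; ring) (by apply ne_of_lt; linarith)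
  have s₅ := split (u₀ := x) (u₁ := 0) (v₀ := x) (v₁ := h) (w₀ := x + y) (w₁ := 0) (p₀ := x)
    (p₁ := h * y / (x + y)) (y / (x + y)) (by positivity) l₂ (by ring)
    (by field_simp; ring) (by apply ne_of_lt; linarith)
  have s₆ := split (u₀ := x) (u₁ := 0) (v₀ := x) (v₁ := h) (w₀ := 0) (w₁ := h) (p₀ := x)
    (p₁ := h * y / (x + y)) (y / (x + y)) (by positivity) l₂ (by ring)
    (by field_simp; ring) (by apply ne_of_gt; linarith)
  have r₂ : F {!₂[0, h], !₂[x + y, h], !₂[x + y, 0]} = rightValue F h (x + y) := by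
    rw [apply_swap (F := F)]
    exact apply_eq_rightValue hinv (by rw [zero_sub, abs_neg, abs_of_pos hxy])
      (by rw [zero_sub, abs_neg, abs_of_pos hh])
  have r₃ : F {!₂[x, h], !₂[x + y, h], !₂[x + y, 0]} = rightValue F h y := by
    rw [apply_swap (F := F)]
    exact apply_eq_rightValue hinv (by rw [sub_add_cancel_left, abs_neg, abs_of_pos hy])
      (by rw [zero_sub, abs_neg, abs_of_pos hh])
  have r₅ : F {!₂[x, 0], !₂[x, h], !₂[x + y, 0]} = rightValue F h y := by
    rw [Finset.pair_comm]
    exact apply_eq_rightValue hinv (by rw [add_sub_cancel_left, abs_of_pos hy])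
      (by rw [sub_zero, abs_of_pos hh])
  have r₆ : F {!₂[x, 0], !₂[x, h], !₂[0, h]} = rightValue F h x := by
    rw [apply_rotate (F := F)]
    exact apply_eq_rightValue hinv (by rw [zero_sub, abs_neg, abs_of_pos hx])
      (by rw [zero_sub, abs_neg, abs_of_pos hh])
  rw [r₂, r₃] at s₂
  rw [r₅] at s₅
  rw [r₆] at s₆
  change rightValue F h (x + y) = rightValue F h x + _ at s₁
  have q₁ := apply_rotate (F := F) !₂[x, 0] !₂[x + y, 0] !₂[0, h]
  have q₂ := apply_rotate (F := F) !₂[x + y, 0] !₂[0, h] !₂[x, h]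
  have q₃ := apply_rotate (F := F) !₂[x + y, 0] !₂[x, h * y / (x + y)] !₂[x, h]
  have q₄ := apply_rotate (F := F) !₂[x, 0] !₂[x, h * y / (x + y)] !₂[0, h]
  have q₅ := (apply_rotate (F := F) !₂[x, 0] !₂[x, h * y / (x + y)] !₂[x + y, 0]).trans
    (apply_swap _ _ _)
  have q₆ := (apply_swap (F := F) !₂[x, h * y / (x + y)] !₂[x, h] !₂[0, h]).trans
    (apply_rotate _ _ _)
  linarith

end Invariant

section Invariant

variable {F : Finset (EuclideanSpace ℝ (Fin 2)) → ℝ}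
  (hinv : ∀ (φ : EuclideanSpace ℝ (Fin 2) ≃ᵢ EuclideanSpace ℝ (Fin 2))
    (s : Finset (EuclideanSpace ℝ (Fin 2))), F (s.map φ.toEquiv.toEmbedding) = F s)
  (hbound : ∀ r q : ℝ, 0 < r → 0 < q → ∃ e E : ℝ,
    ∀ s : Finset (EuclideanSpace ℝ (Fin 2)), s.card = 3 →
      (∀ u ∈ s, ∀ v ∈ s, u ≠ v → 2 * r ≤ dist u v) →
      HasCircumradiusLE 2 s q → e ≤ F s ∧ F s ≤ E)

include hbound in
theorem rightValue_bounded {h : ℝ} (hh : 0 < h) :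
    ∃ B, ∀ y, 1 ≤ y → y ≤ 2 → |rightValue F h y| ≤ B := by
  obtain ⟨e, E, hF⟩ := hbound (min 1 h / 2) ((2 + h) / 2) (by positivity) (by positivity)
  refine ⟨|e| + |E|, fun y hy₁ hy₂ => ?_⟩
  have hm₁ := min_le_left 1 h
  have hm₂ := min_le_right 1 h
  have hm₀ : 0 < min 1 h := by positivity
  have d₁ : min 1 h ≤ dist (!₂[0, 0] : EuclideanSpace ℝ (Fin 2)) !₂[y, 0] := by
    rw [← sq_le_sq₀ hm₀.le dist_nonneg, dist_sq_eq_coords]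
    simp only [Matrix.cons_val_zero, Matrix.cons_val_one]
    nlinarith
  have d₂ : min 1 h ≤ dist (!₂[0, 0] : EuclideanSpace ℝ (Fin 2)) !₂[0, h] := by
    rw [← sq_le_sq₀ hm₀.le dist_nonneg, dist_sq_eq_coords]
    simp only [Matrix.cons_val_zero, Matrix.cons_val_one]
    nlinarith
  have d₃ : min 1 h ≤ dist (!₂[y, 0] : EuclideanSpace ℝ (Fin 2)) !₂[0, h] := by
    rw [← sq_le_sq₀ hm₀.le dist_nonneg, dist_sq_eq_coords]
    simp only [Matrix.cons_val_zero, Matrix.cons_val_one]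
    nlinarith
  have hb : e ≤ rightValue F h y ∧ rightValue F h y ≤ E := by
    refine hF _ ?_ ?_ ⟨!₂[y / 2, h / 2], √(y ^ 2 + h ^ 2) / 2, ?_, ?_⟩
    · rw [Finset.card_eq_three]
      exact ⟨_, _, _, dist_pos.1 (hm₀.trans_le d₁), dist_pos.1 (hm₀.trans_le d₂),
        dist_pos.1 (hm₀.trans_le d₃), rfl⟩
    · rw [mul_div_cancel₀ _ two_ne_zero]
      simp only [Finset.mem_insert, Finset.mem_singleton]
      rintro u (rfl | rfl | rfl) v (rfl | rfl | rfl) huv <;>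
        first | exact absurd rfl huv | assumption | (rw [dist_comm]; assumption)
    · have : √(y ^ 2 + h ^ 2) ≤ 2 + h := Real.sqrt_le_iff.2 ⟨by positivity, by nlinarith⟩
      linarith
    · have hs : (√(y ^ 2 + h ^ 2) / 2) ^ 2 = (y ^ 2 + h ^ 2) / 4 := by
        rw [div_pow, Real.sq_sqrt (by positivity)]
        norm_num
      simp only [Finset.mem_insert, Finset.mem_singleton]
      rintro u (rfl | rfl | rfl) <;>
        rw [← sq_eq_sq₀ dist_nonneg (by positivity), hs, dist_sq_eq_coords] <;>
        simp only [Matrix.cons_val_zero, Matrix.cons_val_one] <;> ring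
  rw [abs_le]
  constructor
  · linarith [neg_abs_le e, abs_nonneg E]
  · linarith [le_abs_self E, abs_nonneg e]

variable (hlim : ∀ (X : Set (EuclideanSpace ℝ (Fin 2))) (r R : ℝ), 0 < r → r < R →
    DelaunaySet 2 X r R → Generic 2 X →
    ∀ D : Geometry.SimplicialComplex ℝ (EuclideanSpace ℝ (Fin 2)),
      IsDelaunayTriangulation 2 D X →
      ∃ l : ℝ, Tendsto (fun α : ℝ =>
        (∑ᶠ s ∈ {s : Finset (EuclideanSpace ℝ (Fin 2)) |
            s ∈ D.faces ∧ s.card = 3 ∧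
              (s : Set (EuclideanSpace ℝ (Fin 2))) ⊆ closedBall 0 α}, F s) /
        (volume (closedBall (0 : EuclideanSpace ℝ (Fin 2)) α)).toReal) atTop (nhds l))

include hinv hbound hlim

theorem rightValue_eq {h y : ℝ} (hh : 0 < h) (hy : 0 < y) :
    rightValue F h y = y * h * rightValue F 1 1 := by
  have key {h y : ℝ} (hh : 0 < h) (hy : 0 < y) : rightValue F h y = y * rightValue F h 1 := by
    obtain ⟨B, hB⟩ := rightValue_bounded hbound hh
    exact eq_mul_of_additive_of_bounded (fun _ _ => rightValue_add hinv hlim hh) hB hy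
  rw [key hh hy, rightValue_comm hinv h 1, key one_pos hh, mul_assoc]

theorem apply_eq_base_mul_height {l h x : ℝ} (hl : 0 < l) (hh : 0 < h) :
    F {!₂[0, 0], !₂[l, 0], !₂[x, h]} = l * h * rightValue F 1 1 := by
  have right {p p' y : ℝ} (hy : 0 < y) (hp : |p' - p| = y) :
      F {!₂[p, 0], !₂[p', 0], !₂[p, h]} = y * h * rightValue F 1 1 := by
    rw [← rightValue_eq hinv hbound hlim hh hy]
    exact apply_eq_rightValue hinv hp (by rw [sub_zero, abs_of_pos hh])
  have right' {p p' y : ℝ} (hy : 0 < y) (hp : |p' - p| = y) :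
      F {!₂[p', 0], !₂[p, 0], !₂[p, h]} = y * h * rightValue F 1 1 := by
    rw [Finset.insert_comm]
    exact right hy hp
  have split {a b c : ℝ} (hab : a < b) (hbc : b < c) : F {!₂[a, 0], !₂[c, 0], !₂[x, h]} =
      F {!₂[a, 0], !₂[b, 0], !₂[x, h]} + F {!₂[b, 0], !₂[c, 0], !₂[x, h]} := by
    have hac : 0 < c - a := by linarith
    apply apply_eq_add_of_split hinv hlim (lam := (b - a) / (c - a))
      (div_pos (by linarith) hac) (by rw [div_lt_one hac]; linarith)
    · simp only [Matrix.cons_val_zero]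
      field_simp
      ring
    · simp
    · simp only [Matrix.cons_val_zero, Matrix.cons_val_one, sub_zero, sub_self, zero_mul]
      positivity
  rcases lt_trichotomy x 0 with hx | rfl | hx
  · have := split hx hl
    rw [right (y := l - x) (by linarith) (abs_of_pos (by linarith)),
      right (y := -x) (by linarith) (by rw [zero_sub, abs_of_pos (by linarith)])] at this
    linarith
  · exact right hl (by rw [sub_zero, abs_of_pos hl])
  · rcases lt_trichotomy x l with hxl | rfl | hxl
    · rw [split hx hxl, right' hx (by rw [zero_sub, abs_neg, abs_of_pos hx]),
        right (y := l - x) (by linarith) (abs_of_pos (by linarith))]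
      ring
    · exact right' hl (by rw [zero_sub, abs_neg, abs_of_pos hl])
    · have := split hl hxl
      rw [right' hx (by rw [zero_sub, abs_neg, abs_of_pos hx]),
        right' (y := x - l) (by linarith) (by rw [abs_sub_comm, abs_of_pos (by linarith)])] at this
      linarith

theorem apply_eq_cross_mul (a b c : EuclideanSpace ℝ (Fin 2))
    (hcr : (b 0 - a 0) * (c 1 - a 1) - (b 1 - a 1) * (c 0 - a 0) ≠ 0) :
    F {a, b, c} =
      |(b 0 - a 0) * (c 1 - a 1) - (b 1 - a 1) * (c 0 - a 0)| * rightValue F 1 1 := by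
  set d₀ := b 0 - a 0 with hd₀
  set d₁ := b 1 - a 1 with hd₁
  have hd : 0 < d₀ ^ 2 + d₁ ^ 2 := by
    by_contra! hle
    have e₀ : d₀ = 0 := by nlinarith
    have e₁ : d₁ = 0 := by nlinarith
    simp [e₀, e₁] at hcr
  set L := √(d₀ ^ 2 + d₁ ^ 2) with hL
  have hL0 : 0 < L := Real.sqrt_pos.2 hd
  have hL2 : L ^ 2 = d₀ ^ 2 + d₁ ^ 2 := Real.sq_sqrt hd.le
  obtain ⟨ε, hε, hεeq⟩ : ∃ ε : ℝ, ε ^ 2 = 1 ∧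
      ε * (d₀ * (c 1 - a 1) - d₁ * (c 0 - a 0)) = |d₀ * (c 1 - a 1) - d₁ * (c 0 - a 0)| := by
    rcases hcr.lt_or_gt with h | h
    · exact ⟨-1, by norm_num, by rw [abs_of_neg h, neg_one_mul]⟩
    · exact ⟨1, by norm_num, by rw [abs_of_pos h, one_mul]⟩
  have hcs : (d₀ / L) ^ 2 + (d₁ / L) ^ 2 = 1 := by
    rw [div_pow, div_pow, ← add_div, hL2, div_self hd.ne']
  set φ := planeIsometry a (d₀ / L) (d₁ / L) ε hcs hε with hφ
  have ea : φ !₂[0, 0] = a := by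
    rw [hφ, planeIsometry_apply]
    apply ext_coords <;> simp
  have eb : φ !₂[L, 0] = b := by
    rw [hφ, planeIsometry_apply]
    apply ext_coords
    · simp only [Matrix.cons_val_zero, Matrix.cons_val_one]
      field_simp
      rw [hd₀]
      ring
    · simp only [Matrix.cons_val_zero, Matrix.cons_val_one]
      field_simp
      rw [hd₁]
      ring
  have hc : φ.symm c = !₂[(φ.symm c) 0, |d₀ * (c 1 - a 1) - d₁ * (c 0 - a 0)| / L] := by
    apply ext_coords
    · rfl
    · change ε * (d₀ / L * (c 1 - a 1) - d₁ / L * (c 0 - a 0)) =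
        |d₀ * (c 1 - a 1) - d₁ * (c 0 - a 0)| / L
      rw [← hεeq]
      field_simp
  have key := apply_isometry hinv φ !₂[0, 0] !₂[L, 0] (φ.symm c)
  rw [ea, eb, φ.apply_symm_apply, hc, apply_eq_base_mul_height hinv hbound hlim hL0
    (div_pos (abs_pos.2 hcr) hL0), mul_div_cancel₀ _ hL0.ne'] at key
  exact key

end Invariant

theorem cross_ne_zero_of_not_collinear {a b c : EuclideanSpace ℝ (Fin 2)}
    (h : ¬ Collinear ℝ {a, b, c}) :
    (b 0 - a 0) * (c 1 - a 1) - (b 1 - a 1) * (c 0 - a 0) ≠ 0 := by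
  contrapose! h
  rw [collinear_iff_of_mem (p₀ := a) (by simp)]
  by_cases hd : (b 0 - a 0) ^ 2 + (b 1 - a 1) ^ 2 = 0
  · have e₀ : b 0 - a 0 = 0 := by nlinarith
    have e₁ : b 1 - a 1 = 0 := by nlinarith
    obtain rfl : b = a := ext_coords (sub_eq_zero.1 e₀) (sub_eq_zero.1 e₁)
    refine ⟨c - b, ?_⟩
    rintro p (rfl | rfl | rfl)
    · exact ⟨0, by simp⟩
    · exact ⟨0, by simp⟩
    · exact ⟨1, by simp⟩
  · refine ⟨b - a, ?_⟩
    rintro p (rfl | rfl | rfl)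
    · exact ⟨0, by simp⟩
    · exact ⟨1, by simp⟩
    · refine ⟨((b 0 - a 0) * (p 0 - a 0) + (b 1 - a 1) * (p 1 - a 1)) /
        ((b 0 - a 0) ^ 2 + (b 1 - a 1) ^ 2), ext_coords ?_ ?_⟩ <;>
        simp only [vadd_eq_add, PiLp.add_apply, PiLp.smul_apply, PiLp.sub_apply, smul_eq_mul] <;>
        field_simp
      · linear_combination -(b 1 - a 1) * h
      · linear_combination (b 0 - a 0) * h

/-- The linear map of the plane with columns `v` and `w`. -/
def columnMap (v w : EuclideanSpace ℝ (Fin 2)) :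
    EuclideanSpace ℝ (Fin 2) →ₗ[ℝ] EuclideanSpace ℝ (Fin 2) where
  toFun z := z 0 • v + z 1 • w
  map_add' x y := by
    simp only [PiLp.add_apply]
    module
  map_smul' k x := by
    simp only [PiLp.smul_apply, smul_eq_mul, RingHom.id_apply]
    module

theorem det_columnMap (v w : EuclideanSpace ℝ (Fin 2)) :
    LinearMap.det (columnMap v w) = v 0 * w 1 - v 1 * w 0 := by
  rw [← LinearMap.det_toMatrix (EuclideanSpace.basisFun (Fin 2) ℝ).toBasis, Matrix.det_fin_two]
  simp [LinearMap.toMatrix_apply, columnMap]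
  ring

open scoped Pointwise in
theorem volume_convexHull_triple (a b c : EuclideanSpace ℝ (Fin 2)) :
    volume (convexHull ℝ {a, b, c}) =
      ENNReal.ofReal |(b 0 - a 0) * (c 1 - a 1) - (b 1 - a 1) * (c 0 - a 0)| *
        volume (convexHull ℝ {(!₂[0, 0] : EuclideanSpace ℝ (Fin 2)), !₂[1, 0], !₂[0, 1]}) := by
  have himage : ({a, b, c} : Set (EuclideanSpace ℝ (Fin 2))) = a +ᵥ
      columnMap (b - a) (c - a) '' {!₂[0, 0], !₂[1, 0], !₂[0, 1]} := by
    simp only [Set.image_insert_eq, Set.image_singleton, ← Set.image_vadd]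
    simp [columnMap]
  rw [himage, convexHull_vadd, ← LinearMap.image_convexHull, measure_vadd,
    Measure.addHaar_image_linearMap, det_columnMap]
  rfl

theorem volume_standard_triangle_pos :
    0 < (volume (convexHull ℝ
      {(!₂[0, 0] : EuclideanSpace ℝ (Fin 2)), !₂[1, 0], !₂[0, 1]})).toReal := by
  have hne {x y : EuclideanSpace ℝ (Fin 2)} (h : (x 0 - y 0) ^ 2 + (x 1 - y 1) ^ 2 ≠ 0) :
      x ≠ y := by
    rintro rfl
    simp at h
  have hinterior := interior_convexHull_nonempty_of_cocircular
    (s := {!₂[0, 0], !₂[1, 0], !₂[0, 1]})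
    (Finset.card_eq_three.2 ⟨_, _, _, hne (by simp), hne (by simp), hne (by simp), rfl⟩)
    ⟨!₂[1 / 2, 1 / 2], √(1 / 2), by
      simp only [Finset.mem_insert, Finset.mem_singleton]
      rintro u (rfl | rfl | rfl) <;>
        rw [← sq_eq_sq₀ dist_nonneg (by positivity), Real.sq_sqrt (by positivity),
          dist_sq_eq_coords] <;>
        norm_num⟩
  simp only [Finset.coe_insert, Finset.coe_singleton] at hinterior
  refine ENNReal.toReal_pos (Measure.measure_pos_of_nonempty_interior _ hinterior).ne' ?_
  exact ((isBounded_convexHull.2 (Set.toFinite _).isBounded).measure_lt_top).ne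

/-- If an isometry-invariant functional on triangles (bounded on the relevant triangles)
has a well-defined limit density on the Delaunay triangulation of every generic Delaunay
set in the plane, then it is proportional to the area. -/
theorem limit_exists_implies_proportional_to_area
    (F : Finset (EuclideanSpace ℝ (Fin 2)) → ℝ)
    (hinv : ∀ (φ : EuclideanSpace ℝ (Fin 2) ≃ᵢ EuclideanSpace ℝ (Fin 2))
      (s : Finset (EuclideanSpace ℝ (Fin 2))), F (s.map φ.toEquiv.toEmbedding) = F s)
    (hbound : ∀ r q : ℝ, 0 < r → 0 < q → ∃ e E : ℝ,
      ∀ s : Finset (EuclideanSpace ℝ (Fin 2)), s.card = 3 →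
        (∀ u ∈ s, ∀ v ∈ s, u ≠ v → 2 * r ≤ dist u v) →
        HasCircumradiusLE 2 s q → e ≤ F s ∧ F s ≤ E)
    (hlim : ∀ (X : Set (EuclideanSpace ℝ (Fin 2))) (r R : ℝ), 0 < r → r < R →
      DelaunaySet 2 X r R → Generic 2 X →
      ∀ D : Geometry.SimplicialComplex ℝ (EuclideanSpace ℝ (Fin 2)),
        IsDelaunayTriangulation 2 D X →
        ∃ l : ℝ, Filter.Tendsto (fun α : ℝ =>
          (∑ᶠ s ∈ {s : Finset (EuclideanSpace ℝ (Fin 2)) |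
              s ∈ D.faces ∧ s.card = 3 ∧
                (s : Set (EuclideanSpace ℝ (Fin 2))) ⊆ Metric.closedBall 0 α},
            F s) /
          (MeasureTheory.volume (Metric.closedBall (0 : EuclideanSpace ℝ (Fin 2)) α)).toReal)
          Filter.atTop (nhds l)) :
    ∃ c : ℝ, ∀ s : Finset (EuclideanSpace ℝ (Fin 2)), s.card = 3 →
      AffineIndependent ℝ ((↑) : ↑s → EuclideanSpace ℝ (Fin 2)) →
      F s = c * (MeasureTheory.volume (convexHull ℝ (s : Set (EuclideanSpace ℝ (Fin 2))))).toReal := by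
  refine ⟨rightValue F 1 1 / (volume (convexHull ℝ
    {(!₂[0, 0] : EuclideanSpace ℝ (Fin 2)), !₂[1, 0], !₂[0, 1]})).toReal, fun s hs hind => ?_⟩
  have hV := volume_standard_triangle_pos
  have hrank := hind.finrank_vectorSpan (n := 2) (by rw [Fintype.card_coe, hs])
  obtain ⟨a, b, c, -, -, -, rfl⟩ := Finset.card_eq_three.1 hs
  have hcol : ¬ Collinear ℝ {a, b, c} := by
    rw [collinear_iff_finrank_le_one]
    have hrange : Set.range (Subtype.val : ↥({a, b, c} : Finset (EuclideanSpace ℝ (Fin 2))) → _) =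
        {a, b, c} := by
      ext
      simp
    rw [hrange] at hrank
    exact fun h => absurd (hrank.symm.le.trans h) (by norm_num)
  rw [apply_eq_cross_mul hinv hbound hlim a b c (cross_ne_zero_of_not_collinear hcol)]
  simp only [Finset.coe_insert, Finset.coe_singleton]
  rw [volume_convexHull_triple a b c, ENNReal.toReal_mul, ENNReal.toReal_ofReal (abs_nonneg _)]
  field_simp
end
end
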